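/- Let 𝒱 = (V, {a₀, a₁}) be a primitive 2-generated M(α,β)-axial algebra over F. Assume α ≠ 2β and that 𝒱 has a regular axet with |a₀^{Miy(𝒱)}| = 2. Then either 𝒱 is isomorphic to a quotient of a symmetric algebra, or V = V_e, or V = V_o. -/

import Mathlib

namespace AxialFormal

universe u v

variable (F : Type u) [Field F] {V : Type v} [NonUnitalNonAssocCommRing V]
  [Module F V] [SMulCommClass F V V] [IsScalarTower F V V]

/-- The `μ`-eigenspace of the adjoint map `ad_a : x ↦ a * x`. -/
def eigSp (a : V) (μ : F) : Submodule F V where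
  carrier := {w | a * w = μ • w}
  add_mem' := by
    intro x y hx hy
    simp only [Set.mem_setOf_eq] at hx hy ⊢
    rw [mul_add, hx, hy, smul_add]
  zero_mem' := by
    simp only [Set.mem_setOf_eq, mul_zero, smul_zero]
  smul_mem' := by
    intro c x hx
    simp only [Set.mem_setOf_eq] at hx ⊢
    rw [mul_smul_comm, hx, smul_comm]

/-- `a` is a primitive axis of Monster type `(α, β)` in the commutative
(not necessarily associative or unital) `F`-algebra `V`. -/
structure IsAxis (α β : F) (a : V) : Prop where
  idem : a * a = a
  primitive : eigSp F a 1 = Submodule.span F {a}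
  decomp : eigSp F a 1 ⊔ eigSp F a 0 ⊔ eigSp F a α ⊔ eigSp F a β = ⊤
  fusion_one_zero : ∀ u ∈ eigSp F a 1, ∀ w ∈ eigSp F a 0, u * w = 0
  fusion_one_alpha : ∀ u ∈ eigSp F a 1, ∀ w ∈ eigSp F a α, u * w ∈ eigSp F a α
  fusion_one_beta : ∀ u ∈ eigSp F a 1, ∀ w ∈ eigSp F a β, u * w ∈ eigSp F a β
  fusion_zero_zero : ∀ u ∈ eigSp F a 0, ∀ w ∈ eigSp F a 0, u * w ∈ eigSp F a 0
  fusion_zero_alpha : ∀ u ∈ eigSp F a 0, ∀ w ∈ eigSp F a α, u * w ∈ eigSp F a α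
  fusion_zero_beta : ∀ u ∈ eigSp F a 0, ∀ w ∈ eigSp F a β, u * w ∈ eigSp F a β
  fusion_alpha_alpha : ∀ u ∈ eigSp F a α, ∀ w ∈ eigSp F a α,
    u * w ∈ eigSp F a 1 ⊔ eigSp F a 0
  fusion_alpha_beta : ∀ u ∈ eigSp F a α, ∀ w ∈ eigSp F a β, u * w ∈ eigSp F a β
  fusion_beta_beta : ∀ u ∈ eigSp F a β, ∀ w ∈ eigSp F a β,
    u * w ∈ eigSp F a 1 ⊔ eigSp F a 0 ⊔ eigSp F a α

/-- `(V, {a₀, a₁})` is a primitive 2-generated axial algebra of Monster type `(α, β)`. -/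
structure IsTwoGenerated (α β : F) (a₀ a₁ : V) : Prop where
  axis₀ : IsAxis F α β a₀
  axis₁ : IsAxis F α β a₁
  generates : NonUnitalAlgebra.adjoin F {a₀, a₁} = ⊤

/-- `τ` is the Miyamoto involution associated to the axis `a` : it is an algebra
automorphism fixing `V₁ᵃ + V₀ᵃ + Vαᵃ` pointwise and negating `Vβᵃ`. -/
structure IsMiyamoto (α β : F) (a : V) (τ : V ≃ₗ[F] V) : Prop where
  map_mul : ∀ x y : V, τ (x * y) = τ x * τ y
  fix_plus : ∀ w ∈ eigSp F a 1 ⊔ eigSp F a 0 ⊔ eigSp F a α, τ w = w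
  neg_beta : ∀ w ∈ eigSp F a β, τ w = -w

/-- The bi-infinite sequence of axes `a_j`, with `a_{2i} = a₀^{ρ^i}` and
`a_{2i+1} = a₁^{ρ^i}` where `ρ = τ₀τ₁` (as a right action, `v^ρ = τ₁ (τ₀ v)`). -/
def axSeq (a₀ a₁ : V) (τ₀ τ₁ : V ≃ₗ[F] V) (j : ℤ) : V :=
  if j % 2 = 0 then ((τ₁ * τ₀) ^ (j / 2)) a₀ else ((τ₁ * τ₀) ^ ((j - 1) / 2)) a₁

/-- The orbit of `b` under the Miyamoto group `⟨τ₀, τ₁⟩`. -/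
def miyOrbit (τ₀ τ₁ : V ≃ₗ[F] V) (b : V) : Set V :=
  {w | ∃ g ∈ Subgroup.closure ({τ₀, τ₁} : Set (V ≃ₗ[F] V)), g b = w}

/-- The axet of `(V,{a₀,a₁})` is regular: the two orbits have the same cardinality. -/
def HasRegularAxet (a₀ a₁ : V) (τ₀ τ₁ : V ≃ₗ[F] V) : Prop :=
  Nonempty ((miyOrbit F τ₀ τ₁ a₀) ≃ (miyOrbit F τ₀ τ₁ a₁))

/-- The 2-generated axial algebra `(V, {a₀, a₁})` is symmetric: it admits a flip,
i.e. an algebra automorphism interchanging `a₀` and `a₁`. -/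
def IsSymmetric (a₀ a₁ : V) : Prop :=
  ∃ f : V ≃ₗ[F] V, (∀ x y : V, f (x * y) = f x * f y) ∧ f a₀ = a₁ ∧ f a₁ = a₀

/-- A bundled commutative (not necessarily associative or unital) `F`-algebra. -/
structure AlgModel where
  carrier : Type (max u v)
  [isRing : NonUnitalNonAssocCommRing carrier]
  [isModule : Module F carrier]
  [isSMulComm : SMulCommClass F carrier carrier]
  [isTower : IsScalarTower F carrier carrier]

attribute [instance] AlgModel.isRing AlgModel.isModule AlgModel.isSMulComm
  AlgModel.isTower

/-- `(V,{a₀,a₁})` is isomorphic to a quotient of a symmetric primitive 2-generated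
`M(α,β)`-axial algebra: there are such an algebra `(W,{b₀,b₁})` and a surjective
multiplication-preserving linear map `W → V` sending `{b₀,b₁}` to `{a₀,a₁}`. -/
def IsQuotientOfSymmetric (α β : F) (a₀ a₁ : V) : Prop :=
  ∃ M : AlgModel.{u, v} F, ∃ b₀ b₁ : M.carrier,
    IsTwoGenerated F α β b₀ b₁ ∧ IsSymmetric F b₀ b₁ ∧
    ∃ θ : M.carrier →ₗ[F] V, Function.Surjective θ ∧
      (∀ x y : M.carrier, θ (x * y) = θ x * θ y) ∧
      ({θ b₀, θ b₁} : Set V) = {a₀, a₁}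

set_option linter.unusedSectionVars false
set_option linter.unusedSimpArgs false
set_option linter.unusedVariables false

section tb1
variable {F : Type u} [Field F] {V : Type v} [NonUnitalNonAssocCommRing V]
  [Module F V] [SMulCommClass F V V] [IsScalarTower F V V]

/-- the (doubled, scaled) `0`-part of `a1` -/
def Uv (α b l : F) (a0 a1 a3 s : V) : V :=
  (α - 2 * b) • (a1 + a3) - (2 : F) • s + (2 * (l - 2 * b - α * l)) • a0
/-- the scaled `α`-part of `a1` -/
def Vv (b l : F) (a0 a1 a3 s : V) : V := s + b • (a1 + a3) + (2 * b - l) • a0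
def Qv (k : F) (a0 q : V) : V := q - k • a0
def Xv (α k : F) (a0 a2 q : V) : V := α • a2 - (α * k) • a0 - (q - k • a0)
def mu (α b l : F) : F := 2 * b * (α - 2 * b) - 2 * b + (1 - α) * l
def Mm (α b l l' : F) : F := 4 * α ^ 2 - α - 4 * b - 4 * α * l + 4 * (1 - α) * l'

/-- One half of the multiplication table. -/
structure Side (α b : F) (a0 a1 a2 a3 s p q : V) (l k : F) (φ : V →ₗ[F] F) : Prop where
  i0 : a0 * a0 = a0
  i2 : a2 * a2 = a2
  m01 : a0 * a1 = s + (2 * b) • (a0 + a1)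
  m03 : a0 * a3 = s + (2 * b) • (a0 + a3)
  m21 : a2 * a1 = s + (2 * b) • (a2 + a1)
  m23 : a2 * a3 = s + (2 * b) • (a2 + a3)
  m02 : a0 * a2 = q
  m0s : a0 * s = mu α b l • a0 + (α - 2 * b) • (s + b • (a1 + a3))
  m2s : a2 * s = mu α b l • a2 + (α - 2 * b) • (s + b • (a1 + a3))
  m0q : a0 * q = α • q + ((1 - α) * k) • a0
  m2q : a2 * q = α • q + ((1 - α) * k) • a2
  φ0 : φ a0 = 1
  φm : ∀ x, φ (a0 * x) = φ x
  φ1 : φ a1 = l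
  φ3 : φ a3 = l
  φ2 : φ a2 = k
  m13 : a1 * a3 = p
  ne : a0 ≠ a2
  tau : ∃ τ : V →ₗ[F] V, (∀ x y, τ (x * y) = τ x * τ y) ∧ τ a0 = a2 ∧ τ a2 = a0 ∧
    τ a1 = a1 ∧ τ a3 = a3
  fUU : a0 * (Uv α b l a0 a1 a3 s * Uv α b l a0 a1 a3 s) = 0
  fUV : a0 * (Uv α b l a0 a1 a3 s * Vv b l a0 a1 a3 s) =
    α • (Uv α b l a0 a1 a3 s * Vv b l a0 a1 a3 s)
  fVV : ∃ g : F, a0 * (Vv b l a0 a1 a3 s * Vv b l a0 a1 a3 s) = g • a0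
  fqX : a0 * (Qv k a0 q * Xv α k a0 a2 q) = α • (Qv k a0 q * Xv α k a0 a2 q)
  fXX : a0 * (Xv α k a0 a2 q * Xv α k a0 a2 q) = 0
  fqq : ∃ g : F, a0 * (Qv k a0 q * Qv k a0 q) = g • a0
  fqU : a0 * (Qv k a0 q * Uv α b l a0 a1 a3 s) = α • (Qv k a0 q * Uv α b l a0 a1 a3 s)
  fqV : ∃ g : F, a0 * (Qv k a0 q * Vv b l a0 a1 a3 s) = g • a0

variable {α b l l' k k' : F} {a0 a1 a2 a3 s p q : V} {φ φ' : V →ₗ[F] F}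

theorem cancel {W : Type*} [AddCommGroup W] [Module F W] {c : F} (hc : c ≠ 0) {x y : W}
    (h : c • x = c • y) : x = y :=
  smul_right_injective W hc h

theorem of_mkQ {a0 x : V} (hx : (Submodule.span F {a0}).mkQ x = 0) : ∃ c : F, x = c • a0 := by
  rw [Submodule.mkQ_apply, Submodule.Quotient.mk_eq_zero, Submodule.mem_span_singleton] at hx
  obtain ⟨c, hc⟩ := hx
  exact ⟨c, hc.symm⟩

theorem mkQ_self (a0 : V) : (Submodule.span F {a0}).mkQ a0 = 0 := by
  rw [Submodule.mkQ_apply, Submodule.Quotient.mk_eq_zero]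
  exact Submodule.mem_span_singleton_self a0

theorem Side.φs (H : Side α b a0 a1 a2 a3 s p q l k φ) : φ s = l - 2 * b - 2 * b * l := by
  have h := H.φm a1
  rw [H.m01] at h
  simp only [map_add, map_smul, smul_eq_mul, H.φ0, H.φ1] at h
  linear_combination h

theorem Side.φq (H : Side α b a0 a1 a2 a3 s p q l k φ) : φ q = k := by
  rw [← H.m02, H.φm, H.φ2]

theorem Side.ne0 (H : Side α b a0 a1 a2 a3 s p q l k φ) : a0 ≠ 0 := by
  rintro rfl
  simpa using H.φ0

theorem Side.ind (H : Side α b a0 a1 a2 a3 s p q l k φ) (x y z u v w w' w'' c : F)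
    (h : x • (a0 + a2) + y • (a1 + a3) + z • s + u • p + v • q + w • (s * s) + w' • (q * q)
      + w'' • (q * s) = c • a0) : c = 0 := by
  obtain ⟨τ, hm, t0, t2, t1, t3⟩ := H.tau
  have hq : τ q = q := by rw [← H.m02, hm, t0, t2, mul_comm]
  have hp : τ p = p := by rw [← H.m13, hm, t1, t3]
  have hs : τ s = s := by
    have e : s = a0 * a1 - (2 * b) • (a0 + a1) := by rw [H.m01]; abel
    have e2 : s = a2 * a1 - (2 * b) • (a2 + a1) := by rw [H.m21]; abel
    conv_lhs => rw [e]
    rw [map_sub, hm, map_smul, map_add, t0, t1, ← e2]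
  have h' := congrArg τ h
  simp only [map_add, map_smul, hm, t0, t2, t1, t3, hp, hq, hs] at h'
  by_contra hc
  apply H.ne
  apply cancel hc
  rw [← h, ← h']
  module

theorem Side.mod (H : Side α b a0 a1 a2 a3 s p q l k φ) {x y z u v : F}
    (h : ∃ c : F, x • (a0 + a2) + y • (a1 + a3) + z • s + u • p + v • q = c • a0) :
    x • (a0 + a2) + y • (a1 + a3) + z • s + u • p + v • q = 0 := by
  obtain ⟨c, hc⟩ := h
  have := H.ind x y z u v 0 0 0 c (by rw [← hc]; module)
  rw [hc, this, zero_smul]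

theorem Side.A_ne (hF : α ≠ 0) (H : Side α b a0 a1 a2 a3 s p q l k φ) : a0 + a2 ≠ 0 := by
  intro h
  have h2 : a0 * (a0 + a2) = 0 := by rw [h, mul_zero]
  rw [mul_add, H.i0, H.m02] at h2
  have := H.ind 0 0 0 0 1 0 0 0 (-1) (by linear_combination (norm := module) h2)
  exact absurd this (by simp)

theorem K1 (h2 : (2 : F) ≠ 0) (hα : α ≠ 0) (H : Side α b a0 a1 a2 a3 s p q l k φ)
    (H' : Side α b a1 a0 a3 a2 s q p l' k' φ') :
    ∃ h : F, (α - 4 * b) • (a0 * p) =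
      (4 * b * (α - 2 * b)) • q + Mm α b l l' • (s + b • (a1 + a3)) + h • a0 := by
  obtain ⟨g, hg⟩ := H.fVV
  have e1 := H.fUU
  simp only [Uv, Vv] at e1 hg
  have sa0 : s * a0 = _ := (mul_comm _ _).trans H.m0s
  have sa2 : s * a2 = _ := (mul_comm _ _).trans H.m2s
  have sa1 : s * a1 = _ := (mul_comm _ _).trans H'.m0s
  have sa3 : s * a3 = _ := (mul_comm _ _).trans H'.m2s
  have a31 : a3 * a1 = _ := (mul_comm _ _).trans H'.m02
  have a20 : a2 * a0 = _ := (mul_comm _ _).trans H.m02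
  simp only [mul_add, add_mul, mul_sub, sub_mul, mul_smul_comm, smul_mul_assoc,
    H.i0, H.m01, H.m03, H.m0s, H.m02, H'.m01, H'.m21, H'.i0, H'.i2, H'.m02, a31,
    H'.m0s, H'.m2s, sa0, sa1, sa3, smul_add, smul_sub, H.m0q, mu] at e1 hg
  have key : (∃ c : F, (α - 4 * b) • (a0 * p) -
      ((4 * b * (α - 2 * b)) • q + Mm α b l l' • (s + b • (a1 + a3))) = c • a0) := by
    apply of_mkQ
    have z0 := mkQ_self (F := F) a0
    apply_fun (Submodule.span F {a0}).mkQ at e1 hg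
    simp only [map_add, map_sub, map_smul, z0, map_zero, smul_zero, Mm] at e1 hg ⊢
    refine cancel (c := 2 * α) (mul_ne_zero h2 hα) ?_
    linear_combination (norm := module) e1 - (4 : F) • hg
  obtain ⟨c, hc⟩ := key
  exact ⟨c, by linear_combination (norm := module) hc⟩


def K2B (α b l l' : F) : F := 2*(α-4*b)*(α-2*b)*mu α b l' + 4*b*(α-4*b)*(α-2*b)^2
  - 2*b*(α-2*b)*Mm α b l l'
def K2S (α b l l' : F) : F := 4*(α-4*b)^2*(α-2*b) + 4*(α-4*b)*mu α b l' - 2*(α-4*b)*(α-2*b)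
  + 4*(α-4*b)*(α-2*b)^2 - 2*(α-2*b)*Mm α b l l'
def K2h (α b l l' : F) : F := (α-4*b)*(-4*b*(l-2*b-α*l)+4*b*mu α b l'+2*(α-2*b)^2*(2*b-l)
  -2*(α-2*b)*(2*b-l+2*b*l))

theorem K2 (h2 : (2 : F) ≠ 0) (hα : α ≠ 0) (H : Side α b a0 a1 a2 a3 s p q l k φ)
    (H' : Side α b a1 a0 a3 a2 s q p l' k' φ') :
    (4*(α - 4 * b)) • (s*s) = (4*b*(α-4*b)*(α-2*b)) • p - (4*b*α*(α-2*b)) • q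
      + (4*b*(α-4*b)^2*(α-2*b)) • (a0+a2) + K2B α b l l' • (a1+a3) + K2S α b l l' • s ∧ 
    (α-2*b)*((α-4*b)*φ p - 4*b*(α-2*b)*k+Mm α b l l' * (2*b-l)) = K2h α b l l' := by
  obtain ⟨h, hh⟩ := K1 h2 hα H H'
  have e1 := H.fUU
  have e2 := H.fUV
  simp only [Uv, Vv] at e1 e2
  have sa0 : s * a0 = _ := (mul_comm _ _).trans H.m0s
  have sa2 : s * a2 = _ := (mul_comm _ _).trans H.m2s
  have sa1 : s * a1 = _ := (mul_comm _ _).trans H'.m0s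
  have sa3 : s * a3 = _ := (mul_comm _ _).trans H'.m2s
  have a31 : a3 * a1 = _ := (mul_comm _ _).trans H'.m02
  have a20 : a2 * a0 = _ := (mul_comm _ _).trans H.m02
  have a10 : a1 * a0 = _ := (mul_comm _ _).trans H.m01
  have a30 : a3 * a0 = _ := (mul_comm _ _).trans H.m03
  simp only [mul_add, add_mul, mul_sub, sub_mul, mul_smul_comm, smul_mul_assoc,
    H.i0, H.m01, H.m03, H.m0s, H.m02, H'.m01, H'.m21, H'.i0, H'.i2, H'.m02, a31,
    H'.m0s, H'.m2s, sa0, sa1, sa3, smul_add, smul_sub, H.m0q, a10, a30] at e1 e2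
  have key : (4*(α - 4 * b)) • (s*s) = (4*b*(α-4*b)*(α-2*b)) • p - (4*b*α*(α-2*b)) • q
      + (4*b*(α-4*b)^2*(α-2*b)) • (a0+a2) + K2B α b l l' • (a1+a3) + K2S α b l l' • s
      + (-2*((α-2*b)*h-K2h α b l l')) • a0 := by
    simp only [K2B, K2S, K2h]
    refine cancel hα ?_
    simp only [mu, Mm] at *
    linear_combination (norm := skip) (α-4*b) • (e1 + (2 : F) • e2) + (-2*α*(α-2*b)) • hh
    clear e1 e2 hh
    match_scalars <;> ring
  have := H.ind (-(4*b*(α-4*b)^2*(α-2*b))) (-K2B α b l l') (-K2S α b l l')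
    (-(4*b*(α-4*b)*(α-2*b))) (4*b*α*(α-2*b)) (4*(α-4*b)) 0 0 (-2*((α-2*b)*h-K2h α b l l'))
    (by linear_combination (norm := module) key)
  rw [this, zero_smul, add_zero] at key
  refine ⟨key, ?_⟩
  clear e1 e2
  have hphi := congrArg φ hh
  simp only [map_add, map_smul, H.φm, H.φq, H.φs, H.φ0, H.φ1, H.φ3, smul_eq_mul] at hphi
  refine mul_left_cancel₀ h2 ?_
  linear_combination (2*(α-2*b))*hphi - this

end tb1

section tb2
variable {F : Type u} [Field F] {V : Type v} [NonUnitalNonAssocCommRing V]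
  [Module F V] [SMulCommClass F V V] [IsScalarTower F V V]
variable {α b l l' k k' : F} {a0 a1 a2 a3 s p q : V} {φ φ' : V →ₗ[F] F}

structure Ctx (α b l l' k k' : F) (a0 a1 a2 a3 s p q : V) (φ φ' : V →ₗ[F] F) : Prop where
  h2 : (2 : F) ≠ 0
  hα : α ≠ 0
  hα1 : 1 - α ≠ 0
  hb : b ≠ 0
  hδ : α - 2 * b ≠ 0
  hε : α - 4 * b ≠ 0
  H : Side α b a0 a1 a2 a3 s p q l k φ
  H' : Side α b a1 a0 a3 a2 s q p l' k' φ'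

theorem Ctx.flip (C : Ctx α b l l' k k' a0 a1 a2 a3 s p q φ φ') :
    Ctx α b l' l k' k a1 a0 a3 a2 s q p φ' φ :=
  ⟨C.h2, C.hα, C.hα1, C.hb, C.hδ, C.hε, C.H', C.H⟩

def XX (α b l l' : F) : F := K2B α b l' l - 4 * b * (α - 4 * b) ^ 2 * (α - 2 * b)
def Dd (α b l l' : F) : F := 4 * α * (l' - l) * (1 + α - 4 * b)
def Tt (α b : F) : F := 8 * b * (α - 2 * b) ^ 2

theorem Ctx.T0 (C : Ctx α b l l' k k' a0 a1 a2 a3 s p q φ φ') : Tt α b ≠ 0 := by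
  have : Tt α b = 2 * 2 * 2 * b * (α - 2 * b) ^ 2 := by rw [Tt]; ring
  rw [this]
  have := C.h2; have := C.hb; have := C.hδ
  positivity

theorem Ctx.R3 (C : Ctx α b l l' k k' a0 a1 a2 a3 s p q φ φ') :
    Tt α b • (p - q) = XX α b l l' • (a0 + a2) - XX α b l' l • (a1 + a3) + Dd α b l l' • s := by
  have e1 := (K2 C.h2 C.hα C.H C.H').1
  have e2 := (K2 C.h2 C.hα C.H' C.H).1
  simp only [Tt, XX, Dd, K2B, K2S, mu, Mm] at *
  linear_combination (norm := module) e2 - e1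

theorem Ctx.rel (C : Ctx α b l l' k k' a0 a1 a2 a3 s p q φ φ') {x y z : F}
    (h : x • (a0 + a2) + y • (a1 + a3) + z • s = 0) :
    x + 4 * b * y + mu α b l * z = 0 ∧
    x • q + (2 * y + (α - 2 * b) * z) • (s + b • (a1 + a3)) = 0 := by
  have e := congrArg (a0 * ·) h
  simp only [mul_add, mul_smul_comm, C.H.i0, C.H.m02, C.H.m01, C.H.m03, C.H.m0s, mul_zero] at e
  have e0 := C.H.ind 0 ((2 * y + (α - 2 * b) * z)*b) (2 * y + (α - 2 * b) * z) 0 x 0 0 0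
    (-(x + 4 * b * y + mu α b l * z)) (by linear_combination (norm := module) e)
  have e1 : x + 4 * b * y + mu α b l * z = 0 := by linear_combination -e0
  refine ⟨e1, ?_⟩
  have : (x + 4 * b * y + mu α b l * z) • a0 = 0 := by rw [e1, zero_smul]
  linear_combination (norm := module) e - this

def QQ (α b l l' : F) : F := Tt α b * (4 * b * (α - 2 * b) - (α - 4 * b) * α)
  - (α - 4 * b) * XX α b l l'
def NN (α b l l' : F) : F := (α - 4 * b) * (Dd α b l l' * (α - 2 * b) - 2 * XX α b l' l)
  - Tt α b * Mm α b l l'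

theorem Ctx.R1 (C : Ctx α b l l' k k' a0 a1 a2 a3 s p q φ φ') :
    QQ α b l l' • q = NN α b l l' • (s + b • (a1 + a3)) ∧
    QQ α b l l' * k = NN α b l l' * (l - 2 * b) := by
  obtain ⟨h, hh⟩ := K1 C.h2 C.hα C.H C.H'
  have e := congrArg (a0 * ·) C.R3
  simp only [mul_add, mul_sub, mul_smul_comm, C.H.i0, C.H.m02, C.H.m01, C.H.m03, C.H.m0s,
    C.H.m0q] at e
  have e1 : ∃ c : F, QQ α b l l' • q - NN α b l l' • (s + b • (a1 + a3)) = c • a0 := by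
    simp only [QQ, NN]
    refine ⟨-(Tt α b * h) + (α-4*b)*(Tt α b *((1-α)*k) + XX α b l l' - 4*b * XX α b l' l
      + Dd α b l l' * mu α b l), ?_⟩
    linear_combination (norm := skip) (α - 4 * b) • e - Tt α b • hh
    clear e hh
    match_scalars <;> ring
  obtain ⟨c, hc⟩ := e1
  have c0 := C.H.ind 0 (-NN α b l l' * b) (-NN α b l l') 0 (QQ α b l l') 0 0 0 c
    (by rw [← hc]; module)
  rw [c0, zero_smul, sub_eq_zero] at hc
  refine ⟨hc, ?_⟩
  have := congrArg φ hc
  simp only [map_add, map_smul, C.H.φq, C.H.φs, C.H.φ1, C.H.φ3, smul_eq_mul] at this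
  linear_combination this

theorem Ctx.qq (C : Ctx α b l l' k k' a0 a1 a2 a3 s p q φ φ') :
    q * q = (2 * α ^ 2 + (1 - α) * k - α) • q + (α * (1 - α) * k) • (a0 + a2) := by
  have hg := C.H.fXX
  have e := C.H.fqX
  simp only [Qv, Xv] at e hg
  have qa0 : q * a0 = _ := (mul_comm _ _).trans C.H.m0q
  have qa2 : q * a2 = _ := (mul_comm _ _).trans C.H.m2q
  have a20 : a2 * a0 = _ := (mul_comm _ _).trans C.H.m02
  simp only [mul_add, add_mul, mul_sub, sub_mul, mul_smul_comm, smul_mul_assoc,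
    C.H.i0, C.H.m02, qa0, qa2, C.H.m0q, C.H.i2, a20, C.H.m2q, smul_add, smul_sub] at e hg
  have key : ∃ c : F, q * q - ((2 * α ^ 2 + (1 - α) * k - α) • q + (α * (1 - α) * k) • (a0 + a2))
      = c • a0 := by
    apply of_mkQ
    have z0 := mkQ_self (F := F) a0
    apply_fun (Submodule.span F {a0}).mkQ at e hg
    simp only [map_add, map_sub, map_smul, z0, map_zero, smul_zero] at e hg ⊢
    refine cancel (c := α) C.hα ?_
    linear_combination (norm := skip) e + hg
    clear e hg
    match_scalars <;> ring
  obtain ⟨c, hc⟩ := key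
  have c0 := C.H.ind (-(α * (1 - α) * k)) 0 0 0 (-(2 * α ^ 2 + (1 - α) * k - α)) 0 1 0 c
    (by rw [← hc]; module)
  rw [c0, zero_smul, sub_eq_zero] at hc
  exact hc

theorem Ctx.J (C : Ctx α b l l' k k' a0 a1 a2 a3 s p q φ φ') :
    ((2 * α - 1) * (α - 2 * k)) • q = 0 := by
  obtain ⟨g, hg⟩ := C.H.fqq
  simp only [Qv] at hg
  have qa0 : q * a0 = _ := (mul_comm _ _).trans C.H.m0q
  simp only [mul_add, add_mul, mul_sub, sub_mul, mul_smul_comm, smul_mul_assoc,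
    C.H.i0, C.H.m02, qa0, C.H.m0q, smul_add, smul_sub, C.qq] at hg
  have key : ∃ c : F, ((2 * α - 1) * (α - 2 * k)) • q = c • a0 := by
    have : ∃ c : F, ((2 * α - 1) * (α - 2 * k)) • q - (0:V) = c • a0 := by
      apply of_mkQ
      have z0 := mkQ_self (F := F) a0
      apply_fun (Submodule.span F {a0}).mkQ at hg
      simp only [map_add, map_sub, map_smul, z0, map_zero, smul_zero] at hg ⊢
      refine cancel (c := α) C.hα ?_
      linear_combination (norm := module) hg
    simpa using this
  obtain ⟨c, hc⟩ := key
  have c0 := C.H.ind 0 0 0 0 ((2 * α - 1) * (α - 2 * k)) 0 0 0 c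
    (by rw [← hc]; module)
  rw [hc, c0, zero_smul]

end tb2

section tb3
variable {F : Type u} [Field F] {V : Type v} [NonUnitalNonAssocCommRing V]
  [Module F V] [SMulCommClass F V V] [IsScalarTower F V V]
variable {α b l l' k k' : F} {a0 a1 a2 a3 s p q : V} {φ φ' : V →ₗ[F] F}
theorem Ctx.K1c (C : Ctx α b l l' k k' a0 a1 a2 a3 s p q φ φ') {x y z w : F}
    (h : p = x • (a0 + a2) + y • (a1 + a3) + z • s + w • q) :
    ((α - 4 * b) * (x + w * α) - 4 * b * (α - 2 * b)) • q +
      ((α - 4 * b) * (2 * y + (α - 2 * b) * z) - Mm α b l l') • (s + b • (a1 + a3)) = 0 := by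
  obtain ⟨g, hh⟩ := K1 C.h2 C.hα C.H C.H'
  have e : a0 * p = _ := congrArg (a0 * ·) h
  simp only [mul_add, mul_smul_comm, C.H.i0, C.H.m02, C.H.m01, C.H.m03, C.H.m0s, C.H.m0q] at e
  rw [e] at hh
  have c0 := C.H.ind 0 (((α - 4 * b) * (2 * y + (α - 2 * b) * z) - Mm α b l l') * b)
    ((α - 4 * b) * (2 * y + (α - 2 * b) * z) - Mm α b l l') 0
    ((α - 4 * b) * (x + w * α) - 4 * b * (α - 2 * b)) 0 0 0
    (g - (α - 4 * b) * (x + 4 * b * y + mu α b l * z + w * ((1 - α) * k)))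
    (by linear_combination (norm := module) hh)
  have : (g - (α - 4 * b) * (x + 4 * b * y + mu α b l * z + w * ((1 - α) * k))) • a0 = 0 := by
    rw [c0, zero_smul]
  linear_combination (norm := module) hh + this

theorem Ctx.A_ne (C : Ctx α b l l' k k' a0 a1 a2 a3 s p q φ φ') : a0 + a2 ≠ 0 :=
  C.H.A_ne C.hα
theorem Ctx.B_ne (C : Ctx α b l l' k k' a0 a1 a2 a3 s p q φ φ') : a1 + a3 ≠ 0 :=
  C.H'.A_ne C.hα

theorem Ctx.M_sub (C : Ctx α b l l' k k' a0 a1 a2 a3 s p q φ φ')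
    (h : Mm α b l l' = Mm α b l' l) : l = l' := by
  simp only [Mm] at h
  have h4 : (4 : F) * (l - l') = 0 := by linear_combination -h
  have : (4 : F) ≠ 0 := by
    have := C.h2
    have e : (4 : F) = 2 * 2 := by norm_num
    rw [e]; exact mul_ne_zero this this
  exact sub_eq_zero.mp ((mul_eq_zero.mp h4).resolve_left this)

theorem Ctx.case1_aux (C : Ctx α b l l' k k' a0 a1 a2 a3 s p q φ φ')
    (h16 : 16 * b ^ 2 = 1) (h1 : a1 + a3 = (4 * b) • (a0 + a2))
    (h2 : s + b • (a1 + a3) = (2 * b) • q) (h3 : s + b • (a0 + a2) = (2 * b) • p) (hq : q = 0) :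
    l = l' := by
  have hb := C.hb
  have hbb : (4 * b - 1) * (4 * b + 1) = 0 := by linear_combination h16
  have e1 : (2 * b) • p = (b - 4 * b ^ 2) • (a0 + a2) := by
    rw [hq] at h2
    linear_combination (norm := module) h2 - h3 - b • h1
  have hφ := congrArg φ h1
  have hφ' := congrArg φ' h1
  simp only [map_add, map_smul, C.H.φ0, C.H.φ1, C.H.φ2, C.H.φ3, C.H'.φ0, C.H'.φ1, C.H'.φ2,
    C.H'.φ3, smul_eq_mul] at hφ hφ'
  have hk : k = 0 := by rw [← C.H.φq, hq, map_zero]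
  rcases mul_eq_zero.mp hbb with h | h
  · have hp : p = 0 := by
      refine cancel (c := 2 * b) (mul_ne_zero C.h2 hb) ?_
      rw [e1, smul_zero]
      have : b - 4 * b ^ 2 = 0 := by linear_combination -b * h
      rw [this, zero_smul]
    have hk' : k' = 0 := by rw [← C.H'.φq, hp, map_zero]
    subst hk hk'
    have : 2 * (l - l') = 0 := by linear_combination hφ + hφ' + (1 + 2 * l') * h
    exact sub_eq_zero.mp ((mul_eq_zero.mp this).resolve_left C.h2)
  · exfalso
    have hp : p = a0 + a2 := by
      refine cancel (c := 2 * b) (mul_ne_zero C.h2 hb) ?_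
      rw [e1]
      have : b - 4 * b ^ 2 = 2 * b := by linear_combination -b * h
      rw [this]
    have hp2 : p = - (a1 + a3) := by
      rw [hp, h1]
      have : 4 * b = -1 := by linear_combination h
      rw [this]; module
    have e := congrArg (a1 * ·) hp2
    simp only [mul_neg, mul_add, C.H'.i0, C.H'.m02, C.H'.m0q] at e
    have c0 := C.H'.ind 0 0 0 0 (α + 1) 0 0 0 (-(1 + (1 - α) * k'))
      (by linear_combination (norm := module) e)
    have e3 : (α + 1) • p = 0 := by
      have : (1 + (1 - α) * k') • a1 = 0 := by
        rw [show 1 + (1 - α) * k' = 0 by linear_combination -c0, zero_smul]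
      linear_combination (norm := module) e - this
    rw [hp] at e3
    have := (smul_eq_zero.mp e3).resolve_right C.A_ne
    exact C.hε (by linear_combination this - h)

theorem Ctx.case1 (C : Ctx α b l l' k k' a0 a1 a2 a3 s p q φ φ') {x y : F}
    (h : x • (a0 + a2) + y • (a1 + a3) = 0) (hxy : ¬ (x = 0 ∧ y = 0)) : l = l' := by
  have hb := C.hb
  have r1 := C.rel (x := x) (y := y) (z := 0) (by rw [h, zero_smul, add_zero])
  have r2 := C.flip.rel (x := y) (y := x) (z := 0) (by rw [zero_smul, add_zero, add_comm, h])
  obtain ⟨r1, r1'⟩ := r1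
  obtain ⟨r2, r2'⟩ := r2
  have hx : x ≠ 0 := by
    rintro rfl
    exact hxy ⟨rfl, by linear_combination r2⟩
  have hy : y ≠ 0 := by
    rintro rfl
    exact hxy ⟨by linear_combination r1, rfl⟩
  have h16 : 16 * b ^ 2 = 1 := by
    refine mul_left_cancel₀ hx ?_
    linear_combination 4 * b * r2 - r1
  have h1 : a1 + a3 = (4 * b) • (a0 + a2) := by
    refine cancel hy ?_
    have : (x + 4 * b * y) • (a0 + a2) = 0 := by
      rw [show x + 4 * b * y = 0 by linear_combination r1, zero_smul]
    linear_combination (norm := module) h - this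
  have h2 : s + b • (a1 + a3) = (2 * b) • q := by
    refine cancel (mul_ne_zero C.h2 hy) ?_
    have : (x + 4 * b * y) • q = 0 := by
      rw [show x + 4 * b * y = 0 by linear_combination r1, zero_smul]
    linear_combination (norm := module) r1' - this
  have h3 : s + b • (a0 + a2) = (2 * b) • p := by
    refine cancel (mul_ne_zero C.h2 hx) ?_
    have : (y + 4 * b * x) • p = 0 := by
      rw [show y + 4 * b * x = 0 by linear_combination r2, zero_smul]
    linear_combination (norm := module) r2' - this
  by_cases hq : q = 0
  · exact C.case1_aux h16 h1 h2 h3 hq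
  have h1' : a0 + a2 = (4 * b) • (a1 + a3) := by
    rw [h1, smul_smul, show 4 * b * (4 * b) = 1 by linear_combination h16, one_smul]
  by_cases hp : p = 0
  · exact (C.flip.case1_aux h16 h1' h3 h2 hp).symm
  have e1 : p = ((1 - 4 * b) / 2) • (a0 + a2) + (0 : F) • (a1 + a3) + (0 : F) • s + (1 : F) • q := by
    have := C.h2
    refine cancel (c := 2 * b) (mul_ne_zero C.h2 hb) ?_
    have e : (2 * b) • p = (2 * b) • q + (b - 4 * b ^ 2) • (a0 + a2) := by
      linear_combination (norm := module) h2 - h3 - b • h1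
    rw [e]
    have : (1 - 4 * b) / 2 * (2 * b) = b - 4 * b ^ 2 := by field_simp
    rw [← this]; module
  have e2 : q = ((1 - 4 * b) / 2) • (a1 + a3) + (0 : F) • (a0 + a2) + (0 : F) • s + (1 : F) • p := by
    have hh : ((1 - 4 * b) / 2) * (1 + 4 * b) = 0 := by linear_combination -h16 / 2
    have : (((1 - 4 * b) / 2) * (1 + 4 * b)) • (a0 + a2) = 0 := by rw [hh, zero_smul]
    rw [h1]
    linear_combination (norm := module) -e1 - this
  have k1 := C.K1c e1
  have k2 := C.flip.K1c e2
  rw [h2] at k1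
  rw [h3] at k2
  have k1' : ((α - 4 * b) * ((1 - 4 * b) / 2 + 1 * α) - 4 * b * (α - 2 * b)
    - Mm α b l l' * (2 * b)) • q = 0 := by linear_combination (norm := module) k1
  have k2' : ((α - 4 * b) * ((1 - 4 * b) / 2 + 1 * α) - 4 * b * (α - 2 * b)
    - Mm α b l' l * (2 * b)) • p = 0 := by linear_combination (norm := module) k2
  have k1'' := (smul_eq_zero.mp k1').resolve_right hq
  have k2'' := (smul_eq_zero.mp k2').resolve_right hp
  apply C.M_sub
  refine mul_left_cancel₀ (mul_ne_zero C.h2 hb) ?_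
  linear_combination k2'' - k1''

end tb3

section tb4
variable {F : Type u} [Field F] {V : Type v} [NonUnitalNonAssocCommRing V]
  [Module F V] [SMulCommClass F V V] [IsScalarTower F V V]
variable {α b l l' k k' : F} {a0 a1 a2 a3 s p q : V} {φ φ' : V →ₗ[F] F}
structure Half (α b l l' k x y q1 q2 p1 p2 : F) : Prop where
  a1 : x * q1 = (α - 2 * b - 2 * y) * x
  a2 : x * q2 = (α - 2 * b - 2 * y) * (y + b)
  c1 : ((α - 4 * b) * p1 - 4 * b * (α - 2 * b)) * q1 + (2 * (α - 4 * b) * p2 - Mm α b l l') * x = 0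
  c2 : ((α - 4 * b) * p1 - 4 * b * (α - 2 * b)) * q2
    + (2 * (α - 4 * b) * p2 - Mm α b l l') * (y + b) = 0
  d1 : q2 ≠ 0 → (q1 - α) * (4 * x + 4 * b) + 2 * q2 * p1 = 0
  d2 : q2 ≠ 0 → (q1 - α) * (4 * y + 4 * b) + q2 * (1 + 2 * p2) = (1 - α) * k - α
  e : mu α b l = x + 4 * b * y
  f : (2 * α - 1) * (α - 2 * k) = 0 ∨ (q1 = 0 ∧ q2 = 0)
  g : k = q1 * (1 + k) + 2 * q2 * l
  h1 : (q1 - α) * (1 + 2 * q1) + q2 * (4 * x + 4 * b) = (1 - α) * k - α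
  h2 : (q1 - α) * 2 * q2 + q2 * (4 * y + 4 * b) = 0

structure NZ (α b : F) : Prop where
  h2 : (2 : F) ≠ 0
  hα : α ≠ 0
  hα1 : 1 - α ≠ 0
  hb : b ≠ 0
  hδ : α - 2 * b ≠ 0
  hε : α - 4 * b ≠ 0

variable {x y q1 q2 p1 p2 : F}

theorem sc_sub (Z : NZ α b) (H : Half α b l l' k x y q1 q2 p1 p2)
    (H' : Half α b l' l k' y x p2 p1 q2 q1) (hm : l ≠ l') : 1 - 4 * b ≠ 0 ∧ x ≠ y := by
  have e := H.e
  have e' := H'.e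
  simp only [mu] at e e'
  have : (1 - α) * (l - l') = (1 - 4 * b) * (x - y) := by linear_combination e - e'
  have h := mul_ne_zero Z.hα1 (sub_ne_zero.mpr hm)
  rw [this] at h
  exact ⟨left_ne_zero_of_mul h, sub_ne_zero.mp (right_ne_zero_of_mul h)⟩

theorem sc_x0 (Z : NZ α b) (H : Half α b l l' k x y q1 q2 p1 p2)
    (H' : Half α b l' l k' y x p2 p1 q2 q1) (hm : l ≠ l') (hx : x = 0) : False := by
  obtain ⟨h4b, hxy⟩ := sc_sub Z H H' hm
  obtain ⟨z2, zα, zα1, zb, zδ, zε⟩ := Z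
  subst hx
  have hy : y ≠ 0 := hxy.symm
  have p2e : p2 = α - 2 * b := mul_left_cancel₀ hy (by linear_combination H'.a1)
  have a2 := H.a2
  have ha2 : (α - 2 * b - 2 * y) * (y + b) = 0 := by linear_combination -a2
  have a2' := H'.a2
  rcases mul_eq_zero.mp ha2 with h | h
  · have p1e : p1 = 2 * b := by
      refine mul_left_cancel₀ hy ?_
      linear_combination a2' + b * h
    have c1 := H.c1
    have hq1 : q1 = 0 := by
      refine mul_left_cancel₀ (mul_ne_zero (mul_ne_zero z2 zb) zα) ?_
      rw [p1e] at c1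
      linear_combination -c1
    have p1n : p1 ≠ 0 := by rw [p1e]; exact mul_ne_zero z2 zb
    have d1 := H'.d1 p1n
    have hq2 : q2 = α := by
      refine mul_left_cancel₀ (mul_ne_zero (mul_ne_zero z2 z2) zb) ?_
      rw [p1e, p2e] at d1
      linear_combination d1 - 4 * b * h
    have c2 := H.c2
    have c1' := H'.c1
    rw [p1e, p2e, hq2] at c2
    rw [p2e, hq1, hq2] at c1'
    simp only [Mm] at c1' c2
    have : (2 * 2 * α) * (l - l') = 0 := by
      have hM : α * Mm α b l l' = 2 * α * ((α - 4 * b) * (α - 2 * b) - 2 * b * α) := by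
        simp only [Mm]; grind
      have hM' : (α - 2 * b) * Mm α b l' l = 2 * (α - 2 * b) * ((α - 4 * b) * α - 4 * b * (α - 2 * b)) := by
        simp only [Mm]; grind
      have hM := mul_left_cancel₀ zα (hM.trans (by ring : _ = α * (2 * ((α - 4 * b) * (α - 2 * b) - 2 * b * α))))
      have hM' := mul_left_cancel₀ zδ (hM'.trans (by ring : _ = (α - 2 * b) * (2 * ((α - 4 * b) * α - 4 * b * (α - 2 * b)))))
      simp only [Mm] at hM hM'
      linear_combination α * hM' - α * hM
    exact mul_ne_zero (mul_ne_zero (mul_ne_zero z2 z2) zα) (sub_ne_zero.mpr hm) this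
  · have hyb : y = -b := by linear_combination h
    have p1e : p1 = -(α - 2 * b) := by
      refine mul_left_cancel₀ hy ?_
      linear_combination a2' + (α - 2 * b) * h
    have c1 := H.c1
    have c2 := H.c2
    have hq1 : q1 = 0 := by
      refine mul_left_cancel₀ (mul_ne_zero zδ zα) ?_
      rw [p1e] at c1
      linear_combination -c1
    have hq2 : q2 = 0 := by
      refine mul_left_cancel₀ (mul_ne_zero zδ zα) ?_
      rw [p1e] at c2
      linear_combination -c2 + (2 * (α - 4 * b) * p2 - Mm α b l l') * h
    have p1n : p1 ≠ 0 := by rw [p1e]; exact neg_ne_zero.mpr zδ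
    have d2 := H'.d2 p1n
    have h1 := H'.h1
    rw [p1e, p2e, hq1] at d2
    rw [p1e, p2e, hyb] at h1
    exact mul_ne_zero zε h4b (by linear_combination h1 - d2)

theorem sc_t0 (Z : NZ α b) (H : Half α b l l' k x y q1 q2 p1 p2)
    (H' : Half α b l' l k' y x p2 p1 q2 q1) (hm : l ≠ l') (hx : x ≠ 0) (hy : y ≠ 0)
    (hq1 : q1 = 0) : False := by
  obtain ⟨h4b, hxy⟩ := sc_sub Z H H' hm
  obtain ⟨z2, zα, zα1, zb, zδ, zε⟩ := Z
  have q1e : q1 = α - 2 * b - 2 * y := mul_left_cancel₀ hx (by linear_combination H.a1)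
  have p2e : p2 = α - 2 * b - 2 * x := mul_left_cancel₀ hy (by linear_combination H'.a1)
  have yδ : α - 2 * b - 2 * y = 0 := by rw [← q1e, hq1]
  have hq2 : q2 = 0 := by
    refine mul_left_cancel₀ hx ?_
    rw [H.a2, yδ]; ring
  have yb : y + b ≠ 0 := by
    intro h
    exact zα (by linear_combination yδ + 2 * h)
  have a2' := H'.a2
  have p2n : p2 ≠ 0 := by
    intro h
    apply hxy
    refine mul_left_cancel₀ z2 ?_
    linear_combination p2e - h + yδ
  have hxb : x + b = 0 := by
    by_contra hxb
    have p1n : p1 ≠ 0 := by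
      intro h
      rw [h, ← p2e] at a2'
      exact mul_ne_zero p2n hxb (by linear_combination -a2')
    have d1 := H'.d1 p1n
    rw [hq2] at d1
    have : (p2 - α) * (2 * 2 * (y + b)) = 0 := by linear_combination d1
    have hp : p2 - α = 0 := (mul_eq_zero.mp this).resolve_right
      (mul_ne_zero (mul_ne_zero z2 z2) yb)
    apply hxb
    refine mul_left_cancel₀ z2 ?_
    linear_combination p2e - hp
  have hxe : x = -b := by linear_combination hxb
  have hp2 : p2 = α := by rw [p2e, hxe]; ring
  have hp1 : p1 = 0 := by
    refine mul_left_cancel₀ hy ?_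
    rw [a2', hxb]; ring
  have c1 := H.c1
  have c1' := H'.c1
  have e := H.e
  have e' := H'.e
  have g' := H'.g
  have J' : (2 * α - 1) * (α - 2 * k') = 0 := H'.f.resolve_right (fun h => p2n h.1)
  rw [hp1, hp2, hq1, hxe] at c1
  rw [hp2, hq1, hq2] at c1'
  rw [hxe] at e e'
  rw [hp1, hp2] at g'
  simp only [Mm, mu] at *
  -- M = 2 α ε
  have M1 : 4 * α ^ 2 - α - 4 * b - 4 * α * l + 4 * (1 - α) * l' = 2 * α * (α - 4 * b) := by
    refine mul_left_cancel₀ zb ?_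
    linear_combination c1
  have M2 : 4 * α ^ 2 - α - 4 * b - 4 * α * l' + 4 * (1 - α) * l = - 8 * b * α := by
    refine mul_left_cancel₀ hy ?_
    linear_combination -c1' - 4 * α * b * yδ
  have l1 : (1 - α) * l = b := by linear_combination e + 2 * b * (-yδ)
  have l2 : 2 * ((1 - α) * l') = α + 2 * b - 4 * b * α := by linear_combination 2 * e' - yδ
  have l4 : 4 * l = 2 * α + 1 := by
    refine mul_left_cancel₀ zα ?_
    linear_combination 2 * l2 - M1
  have m2 : 2 * (l' - l) = α ^ 2 := by
    refine mul_left_cancel₀ z2 ?_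
    linear_combination M1 - M2
  have b1 : 4 * b = 1 - α + α ^ 2 := by
    refine mul_left_cancel₀ zα ?_
    linear_combination l2 - 2 * l1 - (1 - α) * m2
  have b2 : 4 * b = (1 - α) * (2 * α + 1) := by linear_combination -4 * l1 + (1 - α) * l4
  have a3 : 3 * α = 2 := by
    refine mul_left_cancel₀ zα ?_
    linear_combination b2 - b1
  have J2 : (2 * α - 1) * (1 + α) = 0 := by
    refine mul_left_cancel₀ zα ?_
    linear_combination -(1 - α) * J' - (2 * α - 1) * 2 * g'
  rcases mul_eq_zero.mp J2 with h | h
  · exact one_ne_zero (α := F) (by linear_combination 3 * h - 2 * a3)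
  · have h5 : (5 : F) = 0 := by linear_combination -a3 + 3 * h
    apply zδ
    refine mul_left_cancel₀ z2 ?_
    linear_combination -b1 + (4 - α) * h - h5

theorem sc_yb (Z : NZ α b) (H : Half α b l l' k x y q1 q2 p1 p2)
    (H' : Half α b l' l k' y x p2 p1 q2 q1) (hm : l ≠ l') (hx : x ≠ 0) (hy : y ≠ 0)
    (hp2 : p2 ≠ 0) (hyb : y = -b) : False := by
  obtain ⟨h4b, hxy⟩ := sc_sub Z H H' hm
  obtain ⟨z2, zα, zα1, zb, zδ, zε⟩ := Z
  have q1e : q1 = α := mul_left_cancel₀ hx (by rw [H.a1, hyb]; ring)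
  have p2e : p2 = α - 2 * b - 2 * x := mul_left_cancel₀ hy (by linear_combination H'.a1)
  have hq2 : q2 = 0 := by
    refine mul_left_cancel₀ hx ?_
    rw [H.a2, hyb]; ring
  have xb : x + b ≠ 0 := by
    intro h
    exact hxy (by rw [hyb]; linear_combination h)
  have a2' := H'.a2
  rw [← p2e, hyb] at a2'
  have p1n : p1 ≠ 0 := by
    intro h
    rw [h] at a2'
    exact mul_ne_zero hp2 xb (by linear_combination -a2')
  have d2 := H'.d2 p1n
  have h1 := H'.h1

  have g := H.g
  have J1 : (2 * α - 1) * (α - 2 * k) = 0 := H.f.resolve_right (fun h => zα (by rw [← q1e, h.1]))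
  have J' : (2 * α - 1) * (α - 2 * k') = 0 := H'.f.resolve_right (fun h => hp2 h.1)
  rw [q1e] at g d2
  rw [hyb] at h1
  have R : -8 * b * (x + b) - p2 * (1 + 2 * α) + 2 * b + 4 * b * p2 = 0 := by
    refine mul_left_cancel₀ xb ?_
    rw [p2e] at *
    linear_combination b * (d2 - h1) + a2' * (1 + 2 * α)
  have J2 : (2 * α - 1) * (1 + α) = 0 := by
    refine mul_left_cancel₀ zα ?_
    linear_combination -(1 - α) * J1 - (2 * α - 1) * 2 * g - (2 * α - 1) * 4 * l * hq2
  rcases mul_eq_zero.mp J2 with h | h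
  · rw [p2e] at R
    have : (1 - 4 * b) * p2 = 0 := by
      rw [p2e]
      refine mul_left_cancel₀ z2 ?_
      grind
    exact mul_ne_zero h4b hp2 this
  · have hα : α = -1 := by linear_combination h
    subst hα
    by_cases h3 : (3 : F) = 0
    · rw [p2e] at R
      have : (1 - 4 * b) * p2 = 0 := by
        rw [p2e]
        refine mul_left_cancel₀ z2 ?_
        grind
      exact mul_ne_zero h4b hp2 this
    · have hk' : 1 + 2 * k' = 0 := by
        refine mul_left_cancel₀ h3 ?_
        linear_combination J'
      have : (x + b) * (2 * (1 + 2 * p2)) = 0 := by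
        grind
      have hp := (mul_eq_zero.mp ((mul_eq_zero.mp this).resolve_left xb)).resolve_left z2
      apply h4b
      refine mul_left_cancel₀ z2 ?_
      grind

theorem sc_main (Z : NZ α b) (H : Half α b l l' k x y q1 q2 p1 p2)
    (H' : Half α b l' l k' y x p2 p1 q2 q1) : l = l' := by
  by_contra hm
  by_cases hx : x = 0
  · exact sc_x0 Z H H' hm hx
  by_cases hy : y = 0
  · exact sc_x0 Z H' H (Ne.symm hm) hy
  by_cases hq1 : q1 = 0
  · exact sc_t0 Z H H' hm hx hy hq1
  by_cases hp2 : p2 = 0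
  · exact sc_t0 Z H' H (Ne.symm hm) hy hx hp2
  by_cases hyb : y = -b
  · exact sc_yb Z H H' hm hx hy hp2 hyb
  by_cases hxb : x = -b
  · exact sc_yb Z H' H (Ne.symm hm) hy hx hq1 hxb
  obtain ⟨z2, zα, zα1, zb, zδ, zε⟩ := Z
  have yb : y + b ≠ 0 := fun h => hyb (by linear_combination h)
  have xb : x + b ≠ 0 := fun h => hxb (by linear_combination h)
  have q1e : q1 = α - 2 * b - 2 * y := mul_left_cancel₀ hx (by linear_combination H.a1)
  have p2e : p2 = α - 2 * b - 2 * x := mul_left_cancel₀ hy (by linear_combination H'.a1)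
  obtain ⟨t, ht⟩ : ∃ t, q1 = t * x := ⟨q1 / x, by field_simp⟩
  obtain ⟨t', ht'⟩ : ∃ t', p2 = t' * y := ⟨p2 / y, by field_simp⟩
  have q2e : q2 = t * (y + b) := mul_left_cancel₀ hx (by rw [H.a2, ← q1e, ht]; ring)
  have p1e : p1 = t' * (x + b) := mul_left_cancel₀ hy (by rw [H'.a2, ← p2e, ht']; ring)
  have tn : t ≠ 0 := by rintro rfl; exact hq1 (by rw [ht, zero_mul])
  have tn' : t' ≠ 0 := by rintro rfl; exact hp2 (by rw [ht', zero_mul])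
  have d1 := H.d1 (by rw [q2e]; exact mul_ne_zero tn yb)
  have d1' := H'.d1 (by rw [p1e]; exact mul_ne_zero tn' xb)
  have r1 : t * x = α - 2 * b - 2 * y := by rw [← ht, q1e]
  have r2 : t' * y = α - 2 * b - 2 * x := by rw [← ht', p2e]
  rw [ht, q2e, p1e] at d1
  rw [ht', q2e, p1e] at d1'
  have η1 : t * (α - 2 * b + b * t') = 2 * α := by
    refine mul_left_cancel₀ (mul_ne_zero z2 xb) ?_
    linear_combination d1 - 2 * (x + b) * t * r2
  have η2 : t' * (α - 2 * b + b * t) = 2 * α := by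
    refine mul_left_cancel₀ (mul_ne_zero z2 yb) ?_
    linear_combination d1' - 2 * (y + b) * t' * r1
  have htt : t = t' := by
    refine mul_left_cancel₀ zδ ?_
    linear_combination η1 - η2
  have c1 := H.c1
  have c1' := H'.c1
  rw [ht, p1e, ht'] at c1
  rw [ht', q2e, ht] at c1'
  have M1 : Mm α b l l' = (α - 4 * b) * t' * (α - 2 * b + b * t) - 4 * b * (α - 2 * b) * t := by
    refine mul_left_cancel₀ hx ?_
    linear_combination -c1 + x * (α - 4 * b) * t' * r1
  have M2 : Mm α b l' l = (α - 4 * b) * t * (α - 2 * b + b * t') - 4 * b * (α - 2 * b) * t' := by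
    refine mul_left_cancel₀ hy ?_
    linear_combination -c1' + y * (α - 4 * b) * t * r2
  rw [← htt] at M1 M2
  simp only [Mm] at M1 M2
  have : (2 * 2) * (l - l') = 0 := by linear_combination M2 - M1
  exact mul_ne_zero (mul_ne_zero z2 z2) (sub_ne_zero.mpr hm) this

end tb4

section tb5
variable {F : Type u} [Field F] {V : Type v} [NonUnitalNonAssocCommRing V]
  [Module F V] [SMulCommClass F V V] [IsScalarTower F V V]
variable {α b l l' k k' : F} {a0 a1 a2 a3 s p q : V} {φ φ' : V →ₗ[F] F}
variable {x y q1 q2 p1 p2 : F}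

theorem Ctx.AA (C : Ctx α b l l' k k' a0 a1 a2 a3 s p q φ φ') :
    (a0 + a2) * (a0 + a2) = (a0 + a2) + (2 : F) • q := by
  have a20 : a2 * a0 = _ := (mul_comm _ _).trans C.H.m02
  simp only [mul_add, add_mul, C.H.i0, C.H.i2, C.H.m02, a20]
  module

theorem Ctx.AB (C : Ctx α b l l' k k' a0 a1 a2 a3 s p q φ φ') :
    (a0 + a2) * (a1 + a3) = (4 : F) • s + (4 * b) • ((a0 + a2) + (a1 + a3)) := by
  simp only [mul_add, add_mul, C.H.m01, C.H.m03, C.H.m21, C.H.m23]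
  module

theorem Ctx.Aq (C : Ctx α b l l' k k' a0 a1 a2 a3 s p q φ φ') :
    (a0 + a2) * q = (2 * α) • q + ((1 - α) * k) • (a0 + a2) := by
  simp only [mul_add, add_mul, C.H.m0q, C.H.m2q]
  module

theorem Ctx.As (C : Ctx α b l l' k k' a0 a1 a2 a3 s p q φ φ') :
    (a0 + a2) * s = mu α b l • (a0 + a2) + (2 * (α - 2 * b)) • (s + b • (a1 + a3)) := by
  simp only [mul_add, add_mul, C.H.m0s, C.H.m2s]
  module

theorem Ctx.NZ (C : Ctx α b l l' k k' a0 a1 a2 a3 s p q φ φ') : NZ α b :=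
  ⟨C.h2, C.hα, C.hα1, C.hb, C.hδ, C.hε⟩

theorem Ctx.half (C : Ctx α b l l' k k' a0 a1 a2 a3 s p q φ φ')
    (hAB : ∀ x y : F, x • (a0 + a2) + y • (a1 + a3) = 0 → x = 0 ∧ y = 0)
    (hs : s = x • (a0 + a2) + y • (a1 + a3)) (hq : q = q1 • (a0 + a2) + q2 • (a1 + a3))
    (hp : p = p1 • (a0 + a2) + p2 • (a1 + a3)) : Half α b l l' k x y q1 q2 p1 p2 := by
  have ext : ∀ {x y x' y' : F}, x • (a0 + a2) + y • (a1 + a3) = x' • (a0 + a2) + y' • (a1 + a3) →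
      x = x' ∧ y = y' := by
    intro x y x' y' h
    obtain ⟨h1, h2⟩ := hAB (x - x') (y - y') (by linear_combination (norm := module) h)
    exact ⟨sub_eq_zero.mp h1, sub_eq_zero.mp h2⟩
  obtain ⟨r1, r2⟩ := C.rel (x := x) (y := y) (z := -1) (by linear_combination (norm := module) -hs)
  have r2' := hAB (x * q1 - (α - 2 * b - 2 * y) * x) (x * q2 - (α - 2 * b - 2 * y) * (y + b))
    (by linear_combination (norm := module) r2 - x • hq - (2 * y - (α - 2 * b)) • hs)
  have k1 := C.K1c (x := p1) (y := p2) (z := 0) (w := 0) (by linear_combination (norm := module) hp)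
  have k1' := hAB (((α - 4 * b) * p1 - 4 * b * (α - 2 * b)) * q1
      + (2 * (α - 4 * b) * p2 - Mm α b l l') * x)
    (((α - 4 * b) * p1 - 4 * b * (α - 2 * b)) * q2
      + (2 * (α - 4 * b) * p2 - Mm α b l l') * (y + b))
    (by linear_combination (norm := module) k1 - ((α - 4 * b) * p1 - 4 * b * (α - 2 * b)) • hq
          - (2 * (α - 4 * b) * p2 - Mm α b l l') • hs)
  have Aq := C.Aq
  have AA := C.AA
  have AB := C.AB
  have BB := C.flip.AA
  have hz : q1 • ((a0 + a2) * (a0 + a2)) + q2 • ((a0 + a2) * (a1 + a3)) =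
      (2 * α) • q + ((1 - α) * k) • (a0 + a2) := by
    rw [← Aq, ← mul_smul_comm, ← mul_smul_comm, ← mul_add, ← hq]
  have hz' := hAB ((q1 - α) * (1 + 2 * q1) + q2 * (4 * x + 4 * b) - ((1 - α) * k - α))
    ((q1 - α) * 2 * q2 + q2 * (4 * y + 4 * b)) (by
      linear_combination (norm := module) hz - q1 • AA - q2 • AB
        - (2 * q1) • hq - (4 * q2) • hs + (2 * α) • hq)
  have hqq : q1 • ((a0 + a2) * q) + q2 • ((a1 + a3) * q) = q * q := by
    rw [← smul_mul_assoc, ← smul_mul_assoc, ← add_mul, ← hq]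
  have hBq : q1 • ((a0 + a2) * (a1 + a3)) + q2 • ((a1 + a3) * (a1 + a3)) = (a1 + a3) * q := by
    rw [mul_comm (a0 + a2) (a1 + a3), ← mul_smul_comm, ← mul_smul_comm, ← mul_add, ← hq]
  have qq := C.qq
  have hd : q2 ≠ 0 → (q1 - α) • ((a0 + a2) * (a1 + a3)) + q2 • ((a1 + a3) * (a1 + a3)) =
      ((1 - α) * k - α) • (a1 + a3) := by
    intro h
    apply cancel h
    have hq' := congrArg (fun v => ((1 - α) * k - α) • v) hq
    linear_combination (norm := module) q2 • hBq + hqq + qq - (q1 + α) • Aq + (α * q1) • AA - α • hz + α • Aq + hq'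
  have hd' : q2 ≠ 0 → _ := fun h => hAB ((q1 - α) * (4 * x + 4 * b) + 2 * q2 * p1)
    ((q1 - α) * (4 * y + 4 * b) + q2 * (1 + 2 * p2) - ((1 - α) * k - α)) (by
      have := hd h
      linear_combination (norm := module) this - (q1 - α) • AB - q2 • BB - (4 * (q1 - α)) • hs
        - (2 * q2) • hp)
  refine ⟨?_, ?_, k1'.1, k1'.2, fun h => (hd' h).1, fun h => by linear_combination (hd' h).2,
    by linear_combination -r1, ?_, ?_, by linear_combination hz'.1, by linear_combination hz'.2⟩
  · linear_combination r2'.1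
  · linear_combination r2'.2
  · rcases smul_eq_zero.mp C.J with h | h
    · exact Or.inl h
    · exact Or.inr (hAB _ _ (by rw [← hq, h]))
  · have := congrArg φ hq
    rw [C.H.φq] at this
    simp only [map_add, map_smul, smul_eq_mul, C.H.φ0, C.H.φ1, C.H.φ2, C.H.φ3] at this
    linear_combination this

theorem Ctx.spanq (C : Ctx α b l l' k k' a0 a1 a2 a3 s p q φ φ')
    (hAB : ∀ x y : F, x • (a0 + a2) + y • (a1 + a3) = 0 → x = 0 ∧ y = 0)
    (hs : s = x • (a0 + a2) + y • (a1 + a3)) (hxy : x ≠ 0 ∨ y ≠ 0) :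
    ∃ q1 q2 : F, q = q1 • (a0 + a2) + q2 • (a1 + a3) := by
  obtain ⟨r1, r2⟩ := C.rel (x := x) (y := y) (z := -1) (by linear_combination (norm := module) -hs)
  by_cases hx : x = 0
  · have hy := hxy.resolve_left (by simpa using hx)
    obtain ⟨r1', r2'⟩ := C.flip.rel (x := y) (y := x) (z := -1)
      (by linear_combination (norm := module) -hs)
    subst hx
    have hy2 := hAB 0 ((2 * y - (α - 2 * b)) * (y + b)) (by
      linear_combination (norm := module) r2 - (2 * y - (α - 2 * b)) • hs)
    have hp : p = (((α - 2 * b) * b / y)) • (a0 + a2) + (α - 2 * b) • (a1 + a3) := by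
      apply cancel hy
      rw [smul_add, smul_smul, mul_div_cancel₀ _ hy]
      linear_combination (norm := module) r2' + (α - 2 * b) • hs
    have k1 := C.K1c (x := (α - 2 * b) * b / y) (y := α - 2 * b) (z := 0) (w := 0)
      (by linear_combination (norm := module) hp)
    have key : ((α - 4 * b) * ((α - 2 * b) * b / y) - 4 * b * (α - 2 * b)) ≠ 0 := by
      intro h
      have h' : (α - 2 * b) * b * (α - 4 * b - 4 * y) = 0 := by
        field_simp at h
        linear_combination h
      have h'' := (mul_eq_zero.mp h').resolve_left (mul_ne_zero C.hδ C.hb)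
      rcases mul_eq_zero.mp hy2.2 with h3 | h3
      · exact C.hα (by linear_combination -h'' - 2 * h3)
      · exact C.hα (by linear_combination h'' + 4 * h3)
    set c := ((α - 4 * b) * ((α - 2 * b) * b / y) - 4 * b * (α - 2 * b)) with hc
    set d := ((α - 4 * b) * (2 * (α - 2 * b)) - Mm α b l l') with hd
    refine ⟨0, - (c⁻¹ * d * (y + b)), ?_⟩
    apply cancel key
    have e : c * c⁻¹ = 1 := mul_inv_cancel₀ key
    have : c • ((0 : F) • (a0 + a2) + (-(c⁻¹ * d * (y + b))) • (a1 + a3)) =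
        - (d * (y + b)) • (a1 + a3) := by
      rw [zero_smul, zero_add, smul_smul]
      congr 1
      linear_combination - d * (y + b) * e
    rw [this]
    linear_combination (norm := module) k1 - d • hs
  · refine ⟨α - 2 * b - 2 * y, (α - 2 * b - 2 * y) * (y + b) / x, ?_⟩
    apply cancel hx
    rw [smul_add, smul_smul _ ((α - 2 * b - 2 * y) * (y + b) / x), mul_div_cancel₀ _ hx]
    linear_combination (norm := module) r2 - (2 * y - (α - 2 * b)) • hs

theorem Ctx.case2 (C : Ctx α b l l' k k' a0 a1 a2 a3 s p q φ φ')
    (hAB : ∀ x y : F, x • (a0 + a2) + y • (a1 + a3) = 0 → x = 0 ∧ y = 0)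
    (hs : s = x • (a0 + a2) + y • (a1 + a3)) : l = l' := by
  have hAB' : ∀ x y : F, x • (a1 + a3) + y • (a0 + a2) = 0 → x = 0 ∧ y = 0 :=
    fun x y h => (hAB y x (by rw [← h, add_comm])).symm
  have hs' : s = y • (a1 + a3) + x • (a0 + a2) := by rw [hs, add_comm]
  by_cases hxy : x ≠ 0 ∨ y ≠ 0
  · obtain ⟨q1, q2, hq⟩ := C.spanq hAB hs hxy
    obtain ⟨p2, p1, hp⟩ := C.flip.spanq hAB' hs' hxy.symm
    exact sc_main C.NZ (C.half hAB hs hq (by rw [hp, add_comm]))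
      (C.flip.half hAB' hs' hp (by rw [hq, add_comm]))
  · push Not at hxy
    obtain ⟨r1, r2⟩ := C.rel (x := x) (y := y) (z := -1) (by linear_combination (norm := module) -hs)
    obtain ⟨r1', r2'⟩ := C.flip.rel (x := y) (y := x) (z := -1)
      (by linear_combination (norm := module) -hs)
    rw [hxy.1, hxy.2] at r1 r1'
    simp only [mu] at r1 r1'
    refine mul_left_cancel₀ C.hα1 ?_
    linear_combination r1' - r1

end tb5

section tb6
variable {F : Type u} [Field F] {V : Type v} [NonUnitalNonAssocCommRing V]
  [Module F V] [SMulCommClass F V V] [IsScalarTower F V V]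
variable {α b l l' k k' : F} {a0 a1 a2 a3 s p q : V} {φ φ' : V →ₗ[F] F}
variable {r κ : F}
/-- scalar data in case 3, one-sided degeneration -/
structure Deg (α b l l' k k' r κ : F) : Prop where
  hr : r * (α - 4 * b) = 4 * (α - 2 * b)
  hM : Mm α b l l' = 4 * (α - 2 * b) ^ 2
  hD : Dd α b l l' = Tt α b * (r - κ)
  hX : XX α b l l' = Tt α b * (r * b - α)
  hX' : 2 * XX α b l' l = - (Tt α b * (α - 2 * b) * κ)
  hK : -((α - 4 * b) * κ * (α - 2 * b) + 8 * b * (α - 2 * b)) * r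
    + 2 * (α - 4 * b) * (2 * α + (α - 2 * b) * κ) - 2 * Mm α b l' l = 0
  hk : k = α * (1 + k) + κ * ((1 - α) * l - 2 * b)
  hk' : k' = r * (l' - 2 * b)
  J : (2 * α - 1) * (α - 2 * k) = 0
  J' : (2 * α - 1) * (α - 2 * k') = 0
  hs : (α-2*b)*((α-4*b)*(r * (l - 2 * b - 2 * b * l + b * (1 + k))) - 4*b*(α-2*b)*k
    + Mm α b l l' * (2*b-l)) = K2h α b l l'

/-- normalised form -/
structure Deg2 (D b l l' k k' r κ : F) : Prop where
  z2 : (2 : F) ≠ 0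
  zb : b ≠ 0
  zD : D ≠ 0
  zp : D + 2 ≠ 0
  zm : D - 2 ≠ 0
  zα : 1 - (D + 2) * b ≠ 0
  ml : l' - l ≠ 0
  hr : r * (D - 2) = 4 * D
  E1 : (D - 2) * (l' - l) = 2 * b ^ 2 * D * (3 * D + 2 - D * κ)
  E4 : (D + 2) * (l' - l) * (1 + (D - 2) * b) = 2 * b ^ 2 * D ^ 2 * (r - κ)
  E5 : κ * D * (D ^ 2 + 8 * D - 4) = - 2 * D ^ 3 + 12 * D ^ 2 + 8 * D + 16
  E6 : 4 * ((D + 2) * b) ^ 2 - (D + 2) * b - 4 * b - 4 * ((D + 2) * b) * l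
    + 4 * (1 - (D + 2) * b) * l' = 4 * D ^ 2 * b ^ 2
  E7 : (D - 2) * (2 * b ^ 2 * D - 2 * b + (1 - (D + 2) * b) * l') + 2 * b ^ 2 * D * (D - 2)
     - 4 * D ^ 2 * b ^ 2 - 2 * b ^ 2 * (D - 2) ^ 2 + 2 * b ^ 2 * D ^ 2 * κ = 0
  hk : k = (D + 2) * b * (1 + k) + κ * ((1 - (D + 2) * b) * l - 2 * b)
  hk' : k' = r * (l' - 2 * b)
  J : (2 * ((D + 2) * b) - 1) * ((D + 2) * b - 2 * k) = 0
  J' : (2 * ((D + 2) * b) - 1) * ((D + 2) * b - 2 * k') = 0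
  hs : D * ((D - 2) * b * (r * (l - 2 * b - 2 * b * l + b * (1 + k)))
     - 4 * b * (D * b) * k + 4 * (D * b) ^ 2 * (2*b-l)) = (D - 2) * (-4*b*(l-2*b-(D + 2) * b*l)
     +4*b*(2 * b ^ 2 * D - 2 * b + (1 - (D + 2) * b) * l')+2*(D * b)^2*(2*b-l)
     -2*(D * b)*(2*b-l+2*b*l))

theorem Deg.norm (Z : NZ α b) (H : Deg α b l l' k k' r κ) (hm : l ≠ l') :
    ∃ D : F, α = (D + 2) * b ∧ Deg2 D b l l' k k' r κ := by
  obtain ⟨z2, zα, zα1, zb, zδ, zε⟩ := Z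
  obtain ⟨D, hD⟩ : ∃ D : F, α = (D + 2) * b := ⟨(α - 2 * b) / b, by field_simp; ring⟩
  refine ⟨D, hD, ?_⟩
  subst hD
  have d : (D + 2) * b - 2 * b = D * b := by ring
  have e : (D + 2) * b - 4 * b = (D - 2) * b := by ring
  obtain ⟨hr, hM, hD, hX, hX', hK, hk, hk', J, J', hs⟩ := H
  simp only [Dd, Tt, XX, K2B, mu] at hD hX hX'
  rw [hM] at hX' hs
  have hM' : Mm ((D + 2) * b) b l' l = 4 * ((D + 2) * b - 2 * b) ^ 2 - 4 * (l' - l) := by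
    rw [← hM]; simp only [Mm]; ring
  rw [hM'] at hX hK
  simp only [Mm, K2h, mu] at hM hs
  simp only [d, e] at zδ zε hr hM hD hX hX' hK hs
  have zD : D ≠ 0 := left_ne_zero_of_mul zδ
  have zm : D - 2 ≠ 0 := left_ne_zero_of_mul zε
  have z4 : (4 : F) ≠ 0 := by
    have : (4 : F) = 2 * 2 := by norm_num
    rw [this]; exact mul_ne_zero z2 z2
  have hr' : r * (D - 2) = 4 * D := mul_left_cancel₀ zb (by linear_combination hr)
  have E1 : (D - 2) * (l' - l) = 2 * b ^ 2 * D * (3 * D + 2 - D * κ) := by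
    refine mul_left_cancel₀ (mul_ne_zero (mul_ne_zero z2 z4) (mul_ne_zero (mul_ne_zero zb zb) zD)) ?_
    linear_combination (D - 2) * b * hD - 2 * (hX - b * hD) + hX' + 8 * b ^ 3 * D ^ 2 * b * hr'
  refine ⟨z2, zb, zD, left_ne_zero_of_mul zα, zm, zα1, sub_ne_zero.mpr (Ne.symm hm), hr', E1,
    ?_, ?_, by linear_combination hM, ?_, hk, hk', J, J', ?_⟩
  · refine mul_left_cancel₀ (mul_ne_zero z4 zb) ?_
    linear_combination hD
  · refine mul_left_cancel₀ (mul_ne_zero z2 (mul_ne_zero zb zb)) ?_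
    linear_combination -(D - 2) * hK + 8 * E1 - ((D - 2) * b * κ * (D * b) + 8 * b * (D * b)) * hr'
  · refine mul_left_cancel₀ (mul_ne_zero z4 (mul_ne_zero (mul_ne_zero zb zb) zD)) ?_
    linear_combination hX'
  · refine mul_left_cancel₀ zb ?_
    linear_combination hs


theorem Deg2.P0 {D : F} (H : Deg2 D b l l' k k' r κ) : D ^ 2 + 8 * D - 4 ≠ 0 := by
  intro P
  obtain ⟨z2, zb, zD, zp, zm, zα, ml, hr, E1, E4, E5, E6, E7, hk, hk', J, J', hs⟩ := H
  have c2 : ∀ {x : F}, 2 * x = 0 → x = 0 := fun h => (mul_eq_zero.mp h).resolve_left z2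
  have h7 : 7 * D - 4 = 0 := by
    apply c2; apply c2; apply c2; apply c2; apply c2
    linear_combination E5 - κ * D * P - (2 * D - 28) * P
  have h11 : (11 : F) = 0 := by
    apply c2; apply c2
    linear_combination 49 * P - (7 * D + 60) * h7
  have hD : D = -1 := by linear_combination 8 * h7 + (3 - 5 * D) * h11
  subst hD
  have hr' : r = 5 := by linear_combination -4 * hr + (1 - r) * h11
  subst hr'
  clear hs J E5 h7 P hk hr
  have e6 : -5 * b - 4 * b * l + 4 * (1 - b) * l' = 0 := by linear_combination E6
  rcases mul_eq_zero.mp J' with h | h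
  · have hb : b = 6 := by linear_combination 6 * h + (-b) * h11
    subst hb
    clear J' hk' h E6 zα zb zm zp zD
    exfalso
    clear z2 c2
    ring_nf at *
    grind
  · have hl : l' = b := by rw [hk'] at h; linear_combination h + (l' - 2 * b) * h11
    rw [hl] at E7 E1 E4 e6
    have e7 : 2 * b * κ = 7 * b - 3 := by
      refine mul_left_cancel₀ zb ?_
      linear_combination E7
    have e6' : -4 * l = 1 + 4 * b := by
      refine mul_left_cancel₀ zb ?_
      linear_combination e6
    have c1 : 2 * b ^ 2 + 3 * b + 3 = 0 := by
      linear_combination -4*E1+4*b*e7-3*e6'+(2*b^2-3*b)*h11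
    have c2 : - 3 * b ^ 2 + 4 * b + 1 = 0 := by
      linear_combination 4*E4-(1-3*b)*e6'-4*b*e7+(3*b^2+b)*h11
    apply zb
    linear_combination 6 * c1 + 4 * c2 - (3 * b + 2) * h11


theorem Deg2.contra {D : F} (H : Deg2 D b l l' k k' r κ) : False := by
  have P0 := H.P0
  obtain ⟨z2, zb, zD, zp, zm, zα, ml, hr, E1, E4, E5, E6, E7, hk, hk', J, J', hs⟩ := H
  have c2 : ∀ {x : F}, 2 * x = 0 → x = 0 := fun h => (mul_eq_zero.mp h).resolve_left z2
  have m1 : (D - 2) * (D ^ 2 + 8 * D - 4) * (l' - l) = 2 * b ^ 2 * D * (D + 2) ^ 2 * (5 * D - 6) := by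
    linear_combination (D ^ 2 + 8 * D - 4) * E1 - 2 * b ^ 2 * D * E5
  have z5 : 5 * D - 6 ≠ 0 := by
    intro h
    rw [h, mul_zero] at m1
    exact mul_ne_zero (mul_ne_zero zm P0) ml m1
  have hb : (D + 2) * (5 * D - 6) * b = D - 10 := by
    refine mul_left_cancel₀ (mul_ne_zero (mul_ne_zero z2 (mul_ne_zero (mul_ne_zero zb zb) zD))
      (mul_ne_zero (mul_ne_zero zp zp) zm)) ?_
    linear_combination (D - 2) * (D ^ 2 + 8 * D - 4) * E4 - (D + 2) * (1 + (D - 2) * b) * m1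
      + 2 * b ^ 2 * D ^ 2 * (D ^ 2 + 8 * D - 4) * hr - 2 * b ^ 2 * D * (D - 2) * E5
  by_cases hα : 2 * ((D + 2) * b) - 1 = 0
  · clear J J'
    have h3 : 3 * D + 14 = 0 := by linear_combination 2 * hb - (5 * D - 6) * hα
    have z3 : (3 : F) ≠ 0 := by
      intro h
      have h14 : (14 : F) = 0 := by linear_combination h3 - D * h
      exact z2 (by linear_combination h14 - 4 * h)
    have hb' : 16 * b + 3 = 0 := by linear_combination 2 * b * h3 - 3 * hα
    have hP : 9 * (D ^ 2 + 8 * D - 4) = - 176 := by linear_combination (3 * D + 10) * h3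
    have z11 : (11 : F) ≠ 0 := fun h => mul_ne_zero (mul_ne_zero z3 z3) P0 (by
      linear_combination hP - 16 * h)
    have e1 : 7 * κ = 34 := by
      refine mul_left_cancel₀ (mul_ne_zero (pow_ne_zero 5 z2) z11) ?_
      linear_combination 27*E5 - κ*(9*D^2+30*D-176)*h3 + (-18*D^2+192*D-824)*h3
    have e2 : 40 * (l' - l) = 21 := by
      refine mul_left_cancel₀ (mul_ne_zero (pow_ne_zero 4 z2) z11) ?_
      linear_combination 54 * m1 + 27 * D * (5 * D - 6) * (2 * (D + 2) * b + 1) * hα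
        - 2 * (l' - l) * (9*D^2+12*D-236) * h3 + 3 * (15 * D - 88) * h3
    have e30 : 2 * (D * b) = 1 - 4 * b := by linear_combination hα
    have e31 : 4 * (l' - l) = 1 - 8 * b + 32 * b ^ 2 := by
      linear_combination 2 * E6 + 2 * (2 * (D * b) + 1 - 4 * b) * e30 + (1 - 4 * ((D + 2) * b) - 2 + 4 * l + 4 * l') * hα
    have e3 : (61 : F) = 0 := by
      linear_combination -40 * e31 + 4 * e2 + (35 - 80 * b) * hb'
    have e4 : D = 36 := by linear_combination -20 * h3 + (D + 4) * e3
    have e5 : b = -4 := by grind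
    subst e4 e5
    have e6 : κ = 31 := by grind
    subst e6
    have e7 : l' = 20 := by grind
    subst e7
    have e8 : l = 21 := by grind
    subst e8
    have e9 : k = 50 := by grind
    have e9 : r = 15 := by grind
    subst e9
    grind
  · have hkk : 2 * k = (D + 2) * b := by
      linear_combination -(mul_eq_zero.mp J).resolve_left hα
    have hkk' : 2 * k' = (D + 2) * b := by
      linear_combination -(mul_eq_zero.mp J').resolve_left hα
    clear J J' hs
    have hl' : 8 * D * (l' - 2 * b) = (D + 2) * (D - 2) * b := by
      rw [hk'] at hkk'
      linear_combination (D - 2) * hkk' - 2 * (l' - 2 * b) * hr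
    have m2 : (D - 2) * (D ^ 2 + 8 * D - 4) * (l' - l) = 2 * b * D * (D + 2) * (D - 10) := by
      linear_combination m1 + 2 * b * D * (D + 2) * hb
    have q4 : (D + 1) * (D ^ 4 - 8 * D ^ 3 + 152 * D ^ 2 - 32 * D + 16) = 0 := by
      have q0 : 16 * D ^ 3 * b * (κ - 2) + (D - 2) ^ 2 * (D + 2) * (1 - (D + 2) * b) = 0 := by
        refine mul_left_cancel₀ zb ?_
        linear_combination 8 * D * E7 - (D - 2) * (1 - (D + 2) * b) * hl'
      refine mul_left_cancel₀ (mul_ne_zero (mul_ne_zero z2 z2) zm) ?_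
      linear_combination (D ^ 2 + 8 * D - 4) * (5 * D - 6) * q0 - 16 * D ^ 2 * b * (5 * D - 6) * E5
        + (64 * D ^ 2 * (D + 1) * (D - 2) + (D - 2) ^ 2 * (D + 2) * (D ^ 2 + 8 * D - 4)) * hb
    have z1 : D + 1 ≠ 0 := by
      intro h
      have hD : D = -1 := by linear_combination h
      subst hD
      have h11 : (11 : F) ≠ 0 := fun h => P0 (by linear_combination -h)
      apply zα
      refine mul_left_cancel₀ h11 ?_
      linear_combination hb
    have f4 := (mul_eq_zero.mp q4).resolve_left z1
    have f7 : -896+3776*D+2080*D^2+5936*D^3+24*D^4+100*D^5+6*D^6-7*D^7 = 0 := by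
      refine mul_left_cancel₀ zb ?_
      linear_combination 2*D*(D+2)*(D-2)*(D^2+8*D-4)*(5*D-6)*E6
        - (D+2)*(D-2)*(D^2+8*D-4)*(5*D-6)*(1-2*(D+2)*b)*hl'
        - 8*D*(D+2)*(5*D-6)*((D+2)*b)*m2
        + b * (32*D*(D-2)*(D^2+8*D-4) +2*(D^2-4)*(D+2)*(D-2)*(D^2+8*D-4)-16*D^2*(D+2)^2*(D-10)) * hb
    have f3 : 7*D^3+3958*D^2-828*D+424 = 0 := by
      refine mul_left_cancel₀ (pow_ne_zero 9 z2) ?_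
      linear_combination (13512+764*D-50*D^2-7*D^3) * f4 - f7
    have hN : (2:F)^10*(3*(11^2*43)) = 0 := by
      linear_combination ((-43129778)*D^0 + (-394799291)*D^1 + (-697837)*D^2) * f4
        + ((1665236)*D^0 + (14894932)*D^1 + (-765769)*D^2 + (99691)*D^3) * f3
    have hN := (mul_eq_zero.mp hN).resolve_left (pow_ne_zero 10 z2)
    clear f7 q4
    rcases mul_eq_zero.mp hN with hp | hN
    · apply zp
      linear_combination ((1)*D^0 + (1)*D^1) * f4 + ((1)*D^0 + (2)*D^1 + (2)*D^2) * f3 -  ((146)*D^0 + (1)*D^1 + (1090)*D^2 + (2137)*D^3 + (2641)*D^4 + (5)*D^5) * hp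
    rcases mul_eq_zero.mp hN with hN | hp
    · have hp : (11 : F) = 0 := pow_eq_zero_iff (two_ne_zero) |>.mp hN
      have : (D + 1) * (D + 4) = 0 := by
        linear_combination ((8)*D^0) * f4 + ((5)*D^0 + (2)*D^1) * f3 -  ((204)*D^0 + (-323)*D^1 + (1759)*D^2 + (717)*D^3 + (2)*D^4) * hp
      have hD := (mul_eq_zero.mp this).resolve_left z1
      have hD : D = -4 := by linear_combination hD
      subst hD
      have hb1 : b = 1 := by linear_combination -4 * hb + (19 * b + 5) * hp
      subst hb1
      have hκ : κ = 6 := by linear_combination 4 * E5 + (110 - 29 * κ) * hp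
      subst hκ
      have e1 : l' = 3 := by grind
      have e2 : l = 10 := by grind
      subst e1 e2
      have e3 : k = -1 := by grind
      subst e3
      grind
    · have hD : D = 4 := by
        linear_combination ((22)*D^0 + (14)*D^1) * f4 + ((2)*D^0 + (38)*D^1 + (41)*D^2) * f3 -  ((27)*D^0 + (325)*D^1 + (-76)*D^2 + (2754)*D^3 + (3778)*D^4 + (7)*D^5) * hp - hp
      subst hD
      have hb1 : b = 3 := by
        have : 14 * b + 1 = 0 := by
          refine mul_left_cancel₀ zp ?_
          linear_combination hb
        linear_combination - 3 * this + b * hp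
      subst hb1
      have e0 : κ = 28 := by grind
      subst e0
      have e1 : l' = 34 := by grind
      subst e1
      have e2 : l = 36 := by grind
      subst e2
      have e3 : k = 9 := by grind
      subst e3
      grind

theorem Deg.contra (Z : NZ α b) (H : Deg α b l l' k k' r κ) : l = l' := by
  by_contra hm
  obtain ⟨D, -, h⟩ := H.norm Z hm
  exact h.contra

end tb6

section tb7a
variable {F : Type u} [Field F] {V : Type v} [NonUnitalNonAssocCommRing V]
  [Module F V] [SMulCommClass F V V] [IsScalarTower F V V]
variable {α b l l' k k' : F} {a0 a1 a2 a3 s p q : V} {φ φ' : V →ₗ[F] F}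

theorem sc3c0 (Z : NZ α b) (hm : l' - l ≠ 0) (hQ : QQ α b l l' = 0) (hQ' : QQ α b l' l = 0)
    (hN : NN α b l l' = 0) (hN' : NN α b l' l = 0) :
    ∃ h : F, α = 20 * h - 3 ∧ b = 7 * h - 1 ∧ 20 * h ^ 2 - 10 * h + 1 = 0 := by
  obtain ⟨z2, zα, zα1, zb, zδ, zε⟩ := Z
  have z4 : (4 : F) ≠ 0 := by
    have : (4 : F) = 2 * 2 := by norm_num
    rw [this]; exact mul_ne_zero z2 z2
  have hX : XX α b l l' = XX α b l' l := by
    refine mul_left_cancel₀ zε ?_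
    simp only [QQ] at hQ hQ'
    linear_combination hQ' - hQ
  obtain ⟨e, he⟩ : ∃ e, e = α - 4 * b := ⟨_, rfl⟩
  have hα : α * (1 + e) = 2 * e := by
    refine mul_left_cancel₀ z2 (mul_left_cancel₀ zδ (mul_left_cancel₀ hm ?_))
    simp only [XX, K2B, mu, Mm] at hX
    rw [he]
    linear_combination hX
  have h4 : 4 * b * (α - 2 * b) = 2 * e ^ 2 := by
    have h := hN
    have h' := hN'
    simp only [NN] at h h'
    rw [← he] at h
    rw [hX, ← he] at h'
    have hMM : Mm α b l l' = Mm α b l' l + 4 * (l' - l) := by simp only [Mm]; ring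
    rw [hMM] at h
    simp only [Dd, Tt] at h h'
    refine mul_left_cancel₀ z2 (mul_left_cancel₀ z4 (mul_left_cancel₀ zδ (mul_left_cancel₀ hm ?_)))
    subst he
    linear_combination h' - h + 8 * (α - 4 * b) * (α - 2 * b) * (l' - l) * hα
  rw [← he] at zε
  have hb : 4 * b = α - e := by linear_combination he
  have h5 : α ^ 2 = 5 * e ^ 2 := by linear_combination 2 * h4 + (4 * b - α - e) * hb
  have q5 : 5 * e ^ 2 + 10 * e + 1 = 0 := by
    refine mul_left_cancel₀ (mul_ne_zero zε zε) ?_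
    linear_combination -(1 + e) ^ 2 * h5 + (α * (1 + e) + 2 * e) * hα
  have ha : 2 * α = - 5 * e - 1 := by
    refine mul_left_cancel₀ zε ?_
    linear_combination -α * hα + (1 + e) * h5 + e * q5
  obtain ⟨h, hh⟩ : ∃ h : F, e = 1 - 8 * h := ⟨(1 - e) / (2 * 2 * 2), by field_simp; ring⟩
  have hα' : α = 20 * h - 3 := by
    refine mul_left_cancel₀ z2 ?_
    linear_combination ha - 5 * hh
  have hb' : b = 7 * h - 1 := by
    refine mul_left_cancel₀ z4 ?_
    linear_combination hb + hα' - hh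
  clear hα ha h5 h4 hb
  have hP : 20 * h ^ 2 - 10 * h + 1 = 0 := by
    rw [hh] at q5
    refine mul_left_cancel₀ (mul_ne_zero z4 z4) ?_
    linear_combination q5
  clear q5
  exact ⟨h, hα', hb', hP⟩

theorem sc3c1 (Z : NZ α b) (hm : l' - l ≠ 0) (hQ : QQ α b l l' = 0) (hQ' : QQ α b l' l = 0)
    (hN : NN α b l l' = 0) (hN' : NN α b l' l = 0) :
    ∃ h : F, α = 20 * h - 3 ∧ b = 7 * h - 1 ∧ 20 * h ^ 2 - 10 * h + 1 = 0 ∧ (5 : F) ≠ 0 ∧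
    3791 - 27432 * h + (-1780 + 12880 * h) * (l + l') = 0 ∧ -22432708 + 162324600 * h = 0 := by
  obtain ⟨h, hα', hb', hP⟩ := sc3c0 Z hm hQ hQ' hN hN'
  obtain ⟨z2, zα, zα1, zb, zδ, zε⟩ := Z
  have z4 : (4 : F) ≠ 0 := by
    have : (4 : F) = 2 * 2 := by norm_num
    rw [this]; exact mul_ne_zero z2 z2
  subst hα' hb'
  obtain ⟨m, hm'⟩ : ∃ m, m = l' - l := ⟨_, rfl⟩
  rw [← hm'] at hm
  have hl' : l' = l + m := by rw [hm']; ring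
  subst hl'
  simp only [NN, QQ, Dd, Tt, XX, K2B, mu, Mm, K2h] at hN hN' hQ hQ'
  have z5 : (5 : F) ≠ 0 := fun h5 => one_ne_zero (α := F) (by
    linear_combination hP - (4 * h ^ 2 - 2 * h) * h5)
  have z25 : (25 : F) ≠ 0 := by
    have : (25 : F) = 5 * 5 := by norm_num
    rw [this]; exact mul_ne_zero z5 z5
  have f1 : 3791 - 27432 * h + (-1780 + 12880 * h) * (2 * l + m) = 0 := by
    refine mul_left_cancel₀ z2 ?_
    linear_combination 25 * (hQ + hQ') - ((-5282) + (5160)*m + (10320)*l + (-76656)*h + (-16960)*h*m + (-33920)*h*l + (406080)*h^2 + (153600)*h^2*m + (307200)*h^2*l + (-1572480)*h^3) * hP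
  have f2 : 15713 - 113700 * h + (-3720 + 26920 * h) * (2 * l + m) = 0 := by
    refine mul_left_cancel₀ z4 ?_
    linear_combination 25 * (hN + hN') - ((-35452) + (23680)*m + (47360)*l + (-778320)*h + (-94880)*h*m + (-189760)*h*l + (4170240)*h^2 + (710400)*h^2*m + (1420800)*h^2*l + (-14515200)*h^3) * hP
  have g1 : -22432708 + 162324600 * h = 0 := by
    linear_combination (-3720 + 26920 * h) * f1 - (-1780 + 12880 * h) * f2 - 36299328 * hP
  exact ⟨h, rfl, rfl, hP, z5, by linear_combination f1, g1⟩

theorem sc3c2 (Z : NZ α b) (hm : l' - l ≠ 0) (hQ : QQ α b l l' = 0) (hQ' : QQ α b l' l = 0)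
    (hN : NN α b l l' = 0) (hN' : NN α b l' l = 0) : 2 * α - 1 ≠ 0 := by
  obtain ⟨h, hα', hb', hP, -, -, g1⟩ := sc3c1 Z hm hQ hQ' hN hN'
  intro ha
  rw [hα'] at ha
  have h40 : 40 * h = 7 := by linear_combination ha
  have h11 : (11 : F) = 0 := by linear_combination -80 * hP + (40 * h - 13) * h40
  have hh : h = 1 := by linear_combination -3 * h40 + (11 * h - 2) * h11
  subst hh
  exact one_ne_zero (α := F) (by linear_combination 7 * g1 - 89022113 * h11)

theorem sc3c (Z : NZ α b) (hm : l' - l ≠ 0) (hQ : QQ α b l l' = 0) (hQ' : QQ α b l' l = 0)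
    (hN : NN α b l l' = 0) (hN' : NN α b l' l = 0) {k π π' : F}
    (K : (α-2*b)*((α-4*b)*π - 4*b*(α-2*b)*k+Mm α b l l' * (2*b-l)) = K2h α b l l')
    (K' : (α-2*b)*((α-4*b)*π' - 4*b*(α-2*b)*k+Mm α b l' l * (2*b-l')) = K2h α b l' l)
    (R : Tt α b * (π - k) = XX α b l l' * (1 + k) - XX α b l' l * (2 * l)
      + Dd α b l l' * (l - 2 * b - 2 * b * l))
    (R' : Tt α b * (k - π') = XX α b l l' * (2 * l') - XX α b l' l * (1 + k)
      + Dd α b l l' * (l' - 2 * b - 2 * b * l')) : False := by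
  obtain ⟨h, hα', hb', hP, z5, f1, g1⟩ := sc3c1 Z hm hQ hQ' hN hN'
  obtain ⟨z2, zα, zα1, zb, zδ, zε⟩ := Z
  have z4 : (4 : F) ≠ 0 := by
    have : (4 : F) = 2 * 2 := by norm_num
    rw [this]; exact mul_ne_zero z2 z2
  subst hα' hb'
  obtain ⟨m, hm'⟩ : ∃ m, m = l' - l := ⟨_, rfl⟩
  rw [← hm'] at hm
  have hl' : l' = l + m := by rw [hm']; ring
  subst hl'
  simp only [NN, QQ, Dd, Tt, XX, K2B, mu, Mm, K2h] at K K' R R'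
  have f1 : 3791 - 27432 * h + (-1780 + 12880 * h) * (2 * l + m) = 0 := by linear_combination f1
  have f3 : 9201 - 66580 * h + (-4440 + 32120 * h) * (2 * l + m) = 0 := by
    refine mul_left_cancel₀ (mul_ne_zero z2 hm) ?_
    linear_combination 25 * ((1 - 8 * h) * (R + R') - 8 * (7 * h - 1) * (6 * h - 1) * (K - K')) - ((-9102)*m + (-400)*m*k + (14280)*m^2 + (28560)*l*m + (-247560)*h*m + (5600)*h*m*k + (-58240)*h*m^2 + (-116480)*h*l*m + (1303040)*h^2*m + (-19200)*h^2*m*k + (425600)*h^2*m^2 + (851200)*h^2*l*m + (-4300800)*h^3*m) * hP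
  have g2 : 724012 - 5239000 * h = 0 := by
    linear_combination (-4440 + 32120 * h) * f1 - (-1780 + 12880 * h) * f3 + 1178272 * hP
  have n1 : (742720 : F) = 0 := by
    linear_combination -(162324600 : F) ^ 2 * hP + (162324600 * 20 * h + 20 * 22432708 - 10 * 162324600) * g1
  have n2 : (157120 : F) = 0 := by
    linear_combination -(5239000 : F) ^ 2 * hP + (-5239000 * 20 * h - 20 * 724012 + 10 * 5239000) * g2
  apply mul_ne_zero (pow_ne_zero 6 z2) z5
  linear_combination 480 * n1 + (-2269) * n2

end tb7a

section tb7
variable {F : Type u} [Field F] {V : Type v} [NonUnitalNonAssocCommRing V]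
  [Module F V] [SMulCommClass F V V] [IsScalarTower F V V]
variable {α b l l' k k' : F} {a0 a1 a2 a3 s p q : V} {φ φ' : V →ₗ[F] F}

theorem ind_flip {A B s : V} (hI : ∀ x y z : F, x • A + y • B + z • s = 0 → x = 0 ∧ y = 0 ∧ z = 0) :
    ∀ x y z : F, x • B + y • A + z • s = 0 → x = 0 ∧ y = 0 ∧ z = 0 := by
  intro x y z h
  obtain ⟨h1, h2, h3⟩ := hI y x z (by rw [← h]; module)
  exact ⟨h2, h1, h3⟩

theorem Ctx.case3a (C : Ctx α b l l' k k' a0 a1 a2 a3 s p q φ φ')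
    (hI : ∀ x y z : F, x • (a0 + a2) + y • (a1 + a3) + z • s = 0 → x = 0 ∧ y = 0 ∧ z = 0)
    {t r : F} (hq : q = t • (s + b • (a1 + a3))) (hp : p = r • (s + b • (a0 + a2))) : l = l' := by
  have R := C.R3
  rw [hq, hp] at R
  obtain ⟨e1, e2, e3⟩ := hI (Tt α b * r * b - XX α b l l') (XX α b l' l - Tt α b * t * b)
    (Tt α b * (r - t) - Dd α b l l') (by linear_combination (norm := module) R)
  have : 2 * (α - 4 * b) ^ 2 * (1 - α) * (l' - l) = 0 := by
    simp only [XX, Dd, K2B, mu, Mm] at e1 e2 e3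
    linear_combination e1 + e2 - b * e3
  have := (mul_eq_zero.mp this).resolve_left
    (mul_ne_zero (mul_ne_zero C.h2 (pow_ne_zero 2 C.hε)) C.hα1)
  linear_combination -this

theorem Ctx.N0 (C : Ctx α b l l' k k' a0 a1 a2 a3 s p q φ φ')
    (hI : ∀ x y z : F, x • (a0 + a2) + y • (a1 + a3) + z • s = 0 → x = 0 ∧ y = 0 ∧ z = 0)
    (hQ : QQ α b l l' = 0) : NN α b l l' = 0 := by
  have := C.R1.1
  rw [hQ, zero_smul] at this
  exact (hI 0 (NN α b l l' * b) (NN α b l l') (by linear_combination (norm := module) -this)).2.2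

/-- a single degenerate relation -/
theorem Ctx.case3d (C : Ctx α b l l' k k' a0 a1 a2 a3 s p q φ φ')
    (hI : ∀ x y z : F, x • (a0 + a2) + y • (a1 + a3) + z • s = 0 → x = 0 ∧ y = 0 ∧ z = 0)
    (hQ : QQ α b l l' = 0) {r : F} (hp : p = r • (s + b • (a0 + a2))) (hp0 : p ≠ 0) : l = l' := by
  have hN := C.N0 hI hQ
  have T0 := C.T0
  have e := C.K1c (x := r * b) (y := 0) (z := r) (w := 0) (by rw [hp]; module)
  by_cases h : (α - 4 * b) * (r * b + 0 * α) - 4 * b * (α - 2 * b) = 0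
  · rw [h, zero_smul, zero_add] at e
    obtain ⟨-, -, e2⟩ := hI 0 (((α - 4 * b) * (2 * 0 + (α - 2 * b) * r) - Mm α b l l') * b)
      ((α - 4 * b) * (2 * 0 + (α - 2 * b) * r) - Mm α b l l')
      (by linear_combination (norm := module) e)
    have hr : r * (α - 4 * b) = 4 * (α - 2 * b) := by
      refine mul_left_cancel₀ C.hb ?_
      linear_combination h
    have hM : Mm α b l l' = 4 * (α - 2 * b) ^ 2 := by
      linear_combination -e2 + (α - 2 * b) * hr
    obtain ⟨κ, hκ⟩ : ∃ κ : F, Dd α b l l' = Tt α b * (r - κ) :=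
      ⟨r - Dd α b l l' / Tt α b, by field_simp; ring⟩
    have hX : XX α b l l' = Tt α b * (r * b - α) := by
      refine mul_left_cancel₀ C.hε ?_
      simp only [QQ] at hQ
      linear_combination -hQ - Tt α b * b * hr
    have hX' : 2 * XX α b l' l = - (Tt α b * (α - 2 * b) * κ) := by
      refine mul_left_cancel₀ C.hε ?_
      simp only [NN] at hN
      rw [hM, hκ] at hN
      linear_combination -hN + Tt α b * (α - 2 * b) * hr
    have hq : (2 : F) • q = (2 * α) • (a0 + a2) + (2 * κ) • s - (κ * (α - 2 * b)) • (a1 + a3) := by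
      have R := C.R3
      refine cancel T0 ?_
      have hX2 : (2 * XX α b l' l) • (a1 + a3) = - (Tt α b * (α - 2 * b) * κ) • (a1 + a3) := by
        rw [hX']
      rw [hκ, hX, hp] at R
      linear_combination (norm := module) (-2 : F) • R + hX2
    have hq' : q = (-(κ * (α - 2 * b)) / 2) • (a1 + a3) + α • (a0 + a2) + κ • s + (0 : F) • p := by
      have h2 := C.h2
      refine cancel C.h2 ?_
      rw [hq]
      match_scalars <;> field_simp <;> ring
    have e' := C.flip.K1c hq'
    have q0 : q ≠ 0 := by
      intro h
      have := (hI (2 * α) (-(κ * (α - 2 * b))) (2 * κ) (by rw [h] at hq; linear_combination (norm := module) -hq)).1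
      exact mul_ne_zero C.h2 C.hα this
    refine Deg.contra C.NZ (r := r) (κ := κ) (k := k) (k' := k') ?_
    have φp : φ p = r * (l - 2 * b - 2 * b * l + b * (1 + k)) := by
      rw [hp]
      simp only [map_add, map_smul, C.H.φs, C.H.φ0, C.H.φ2, smul_eq_mul]
    refine ⟨hr, hM, hκ, hX, hX', ?_, ?_, ?_, ?_, ?_, ?_⟩
    · rw [hp] at e'
      have h2 := C.h2
      have := (hI ((((α - 4 * b) * (-(κ * (α - 2 * b)) / 2 + 0 * α) - 4 * b * (α - 2 * b)) * r
        + ((α - 4 * b) * (2 * α + (α - 2 * b) * κ) - Mm α b l' l)) * b) 0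
        (((α - 4 * b) * (-(κ * (α - 2 * b)) / 2 + 0 * α) - 4 * b * (α - 2 * b)) * r
        + ((α - 4 * b) * (2 * α + (α - 2 * b) * κ) - Mm α b l' l))
        (by linear_combination (norm := module) e')).2.2
      field_simp at this
      linear_combination this
    · have := congrArg φ hq
      simp only [map_add, map_sub, map_smul, C.H.φs, C.H.φ0, C.H.φ2, C.H.φq, C.H.φ1, C.H.φ3, smul_eq_mul] at this
      refine mul_left_cancel₀ C.h2 ?_
      linear_combination this
    · have := congrArg φ' hp
      simp only [map_add, map_sub, map_smul, C.H'.φs, C.H'.φ1, C.H'.φ3, C.H'.φq, smul_eq_mul] at this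
      linear_combination this
    · exact (smul_eq_zero.mp C.J).resolve_right q0
    · exact (smul_eq_zero.mp C.flip.J).resolve_right hp0
    · have := (K2 C.h2 C.hα C.H C.H').2
      rw [φp] at this
      exact this
  · refine C.case3a hI (t := -(((α - 4 * b) * (2 * 0 + (α - 2 * b) * r) - Mm α b l l') / 
      ((α - 4 * b) * (r * b + 0 * α) - 4 * b * (α - 2 * b)))) ?_ hp
    refine cancel h ?_
    rw [smul_smul, mul_neg, mul_div_cancel₀ _ h]
    linear_combination (norm := module) e

theorem Ctx.case3 (C : Ctx α b l l' k k' a0 a1 a2 a3 s p q φ φ')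
    (hI : ∀ x y z : F, x • (a0 + a2) + y • (a1 + a3) + z • s = 0 → x = 0 ∧ y = 0 ∧ z = 0) :
    l = l' := by
  have hI' := ind_flip hI
  have hS : ∀ {α b l l' k k' : F} {a0 a1 a2 a3 s p q : V} {φ φ' : V →ₗ[F] F}
    (C : Ctx α b l l' k k' a0 a1 a2 a3 s p q φ φ') (hQ : QQ α b l l' ≠ 0), ∃ t : F,
      q = t • (s + b • (a1 + a3)) := by
    intro α b l l' k k' a0 a1 a2 a3 s p q φ φ' C hQ
    refine ⟨NN α b l l' / QQ α b l l', cancel hQ ?_⟩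
    rw [C.R1.1, smul_smul, mul_div_cancel₀ _ hQ]
  -- if `p = 0` then `q` is a multiple of `s + b B`
  have h0 : ∀ {α b l l' k k' : F} {a0 a1 a2 a3 s p q : V} {φ φ' : V →ₗ[F] F}
    (C : Ctx α b l l' k k' a0 a1 a2 a3 s p q φ φ')
    (hI : ∀ x y z : F, x • (a0 + a2) + y • (a1 + a3) + z • s = 0 → x = 0 ∧ y = 0 ∧ z = 0)
    (hp : p = 0), l = l' := by
    intro α b l l' k k' a0 a1 a2 a3 s p q φ φ' C hI hp
    have e := C.K1c (x := 0) (y := 0) (z := 0) (w := 0) (by rw [hp]; module)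
    have h : 4 * b * (α - 2 * b) ≠ 0 := by
      have : 4 * b * (α - 2 * b) = 2 * 2 * b * (α - 2 * b) := by ring
      rw [this]
      exact mul_ne_zero (mul_ne_zero (mul_ne_zero C.h2 C.h2) C.hb) C.hδ
    refine C.case3a hI (t := (-Mm α b l l') / (4 * b * (α - 2 * b))) (r := 0) ?_ (by rw [hp, zero_smul])
    refine cancel h ?_
    rw [smul_smul, mul_div_cancel₀ _ h]
    linear_combination (norm := module) -e
  by_cases p0 : p = 0
  · exact h0 C hI p0
  by_cases q0 : q = 0
  · exact (h0 C.flip hI' q0).symm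
  by_cases hQ : QQ α b l l' = 0
  · by_cases hQ' : QQ α b l' l = 0
    · by_contra hm
      have hm : l' - l ≠ 0 := sub_ne_zero.mpr (Ne.symm hm)
      have hN := C.N0 hI hQ
      have hN' := C.flip.N0 hI' hQ'
      have J := (smul_eq_zero.mp C.J).resolve_right q0
      have J' := (smul_eq_zero.mp C.flip.J).resolve_right p0
      have hk : k = k' := by
        have h := sc3c2 C.NZ hm hQ hQ' hN hN'
        have e1 := (mul_eq_zero.mp J).resolve_left h
        have e2 := (mul_eq_zero.mp J').resolve_left h
        refine mul_left_cancel₀ C.h2 ?_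
        linear_combination e2 - e1
      subst hk
      have R := congrArg φ C.R3
      have R' := congrArg φ' C.R3
      simp only [map_add, map_sub, map_smul, C.H.φs, C.H.φ0, C.H.φ2, C.H.φq, C.H.φ1, C.H.φ3,
        C.H'.φs, C.H'.φ0, C.H'.φ2, C.H'.φq, C.H'.φ1, C.H'.φ3, smul_eq_mul] at R R'
      refine sc3c C.NZ hm hQ hQ' hN hN' (K2 C.h2 C.hα C.H C.H').2 (K2 C.h2 C.hα C.H' C.H).2 ?_ ?_
      · linear_combination R
      · linear_combination R'
    · obtain ⟨r, hr⟩ := hS C.flip hQ'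
      exact C.case3d hI hQ hr p0
  · obtain ⟨t, ht⟩ := hS C hQ
    by_cases hQ' : QQ α b l' l = 0
    · exact (C.flip.case3d hI' hQ' ht q0).symm
    · obtain ⟨r, hr⟩ := hS C.flip hQ'
      exact C.case3a hI ht hr

theorem Ctx.l_eq (C : Ctx α b l l' k k' a0 a1 a2 a3 s p q φ φ') : l = l' := by
  by_cases hAB : ∀ x y : F, x • (a0 + a2) + y • (a1 + a3) = 0 → x = 0 ∧ y = 0
  · by_cases hs : ∃ x y : F, s = x • (a0 + a2) + y • (a1 + a3)
    · obtain ⟨x, y, hs⟩ := hs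
      exact C.case2 hAB hs
    · refine C.case3 ?_
      intro x y z h
      have hz : z = 0 := by
        by_contra hz
        refine hs ⟨-x / z, -y / z, cancel hz ?_⟩
        rw [smul_add, smul_smul, smul_smul, mul_div_cancel₀ _ hz, mul_div_cancel₀ _ hz]
        linear_combination (norm := module) h
      subst hz
      obtain ⟨h1, h2⟩ := hAB x y (by rw [← h]; module)
      exact ⟨h1, h2, rfl⟩
  · push Not at hAB
    obtain ⟨x, y, h, hxy⟩ := hAB
    exact C.case1 h (fun h => hxy h.1 h.2)

end tb7

section tb8
variable {F : Type u} [Field F] {V : Type v} [NonUnitalNonAssocCommRing V]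
  [Module F V] [SMulCommClass F V V] [IsScalarTower F V V]
variable {α b l l' k k' : F} {a0 a1 a2 a3 s p q : V} {φ φ' : V →ₗ[F] F}

theorem Ctx.k_eq (C : Ctx α b l l k k' a0 a1 a2 a3 s p q φ φ') : k = k' := by
  have R := congrArg φ C.R3
  have R' := congrArg φ' C.R3
  simp only [map_add, map_sub, map_smul, C.H.φs, C.H.φ0, C.H.φ2, C.H.φq, C.H.φ1, C.H.φ3,
        C.H'.φs, C.H'.φ0, C.H'.φ2, C.H'.φq, C.H'.φ1, C.H'.φ3, smul_eq_mul] at R R'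
  have K := (K2 C.h2 C.hα C.H C.H').2
  have K' := (K2 C.h2 C.hα C.H' C.H).2
  have E : (α - 4 * b) * (φ p - φ' q) = 4 * b * (α - 2 * b) * (k - k') := by
    refine mul_left_cancel₀ C.hδ ?_
    linear_combination K - K'
  have Q := C.R1.2
  have Q' := C.flip.R1.2
  have D0 : Dd α b l l = 0 := by simp only [Dd]; ring
  rw [D0] at R R'
  have : Tt α b * (α - 4 * b) * (1 - α) * (k - k') = 0 := by
    simp only [QQ] at Q Q'
    linear_combination Q - Q' - (α - 4 * b) * (R + R') + Tt α b * E
  have := (mul_eq_zero.mp this).resolve_left (mul_ne_zero (mul_ne_zero C.T0 C.hε) C.hα1)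
  linear_combination this

theorem Ctx.a0p (C : Ctx α b l l' k k' a0 a1 a2 a3 s p q φ φ') :
    ((α - 4 * b) * (α - 2 * b)) • (a0 * p) = (α - 2 * b) •
      ((4 * b * (α - 2 * b)) • q + Mm α b l l' • (s + b • (a1 + a3))) + K2h α b l l' • a0 := by
  obtain ⟨h, hh⟩ := K1 C.h2 C.hα C.H C.H'
  have K := (K2 C.h2 C.hα C.H C.H').2
  have hphi := congrArg φ hh
  simp only [map_add, map_smul, C.H.φm, C.H.φq, C.H.φs, C.H.φ0, C.H.φ1, C.H.φ3, smul_eq_mul] at hphi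
  have e : (α - 2 * b) * h = K2h α b l l' := by
    linear_combination K - (α - 2 * b) * hphi
  rw [← e]
  linear_combination (norm := module) (α - 2 * b) • hh

theorem Ctx.a2p (C : Ctx α b l l' k k' a0 a1 a2 a3 s p q φ φ') :
    ((α - 4 * b) * (α - 2 * b)) • (a2 * p) = (α - 2 * b) •
      ((4 * b * (α - 2 * b)) • q + Mm α b l l' • (s + b • (a1 + a3))) + K2h α b l l' • a2 := by
  obtain ⟨τ, hm, t0, t2, t1, t3⟩ := C.H.tau
  have hq : τ q = q := by rw [← C.H.m02, hm, t0, t2, mul_comm]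
  have hp : τ p = p := by rw [← C.H.m13, hm, t1, t3]
  have hs : τ s = s := by
    have e : s = a0 * a1 - (2 * b) • (a0 + a1) := by rw [C.H.m01]; abel
    have e2 : s = a2 * a1 - (2 * b) • (a2 + a1) := by rw [C.H.m21]; abel
    conv_lhs => rw [e]
    rw [map_sub, hm, map_smul, map_add, t0, t1, ← e2]
  have := congrArg τ C.a0p
  simpa only [map_add, map_smul, hm, t0, t2, t1, t3, hp, hq, hs] using this

theorem Ctx.qs (C : Ctx α b l l' k k' a0 a1 a2 a3 s p q φ φ') :
    (2 * (α - 4 * b) ^ 2 * (α - 2 * b) ^ 2) • (q * s) = 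
    ((α - 4 * b) * (α - 2 * b) ^ 2) • ((8 * b * (α - 2 * b) ^ 2) • p
      + (2 * Mm α b l' l * (α - 2 * b)) • (s + b • (a0 + a2)) + K2h α b l' l • (a1 + a3))
    + ((α - 4 * b) ^ 2 * (α - 2 * b) ^ 2 * (2 * α * (l - 2 * b))) • q
    + (2 * (α - 4 * b) ^ 2 * (α - 2 * b) ^ 2 * k * α) • (s + b • (a1 + a3))
    - ((α - 2 * b)^2 * 8 * b * (α - 2 * b)) • ((4 * b * (α - 2 * b)) • q + Mm α b l l' • (s + b • (a1 + a3)))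
    - (2 * Mm α b l' l * (α - 4 * b) * (α - 2 * b) ^ 2) • ((α - 2 * b) • (s + b • (a1 + a3)) + b • q)
    - (2 * (α - 4 * b) * (α - 2 * b) * K2h α b l' l) • (s + b • (a1 + a3)) := by
  obtain ⟨g, hg⟩ := C.H.fqV
  have e := C.H.fqU
  have h0 := C.a0p
  have h1 := C.flip.a0p
  have h3 := C.flip.a2p
  have hB : ((α - 4 * b) * (α - 2 * b)) • (q * (a1 + a3)) = (α - 2 * b) •
      ((8 * b * (α - 2 * b)) • p + (2 * Mm α b l' l) • (s + b • (a0 + a2)))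
      + K2h α b l' l • (a1 + a3) := by
    rw [mul_comm q, add_mul]
    linear_combination (norm := module) h1 + h3
  obtain ⟨qB, hqB⟩ : ∃ x, x = q * (a1 + a3) := ⟨_, rfl⟩
  have hBa := congrArg (a0 * ·) hB
  simp only [mul_add, mul_smul_comm, C.H.i0, C.H.m02, C.H.m0s, smul_add, C.H.m01, C.H.m03] at hBa
  have sa0 : s * a0 = _ := (mul_comm _ _).trans C.H.m0s
  have qa0 : q * a0 = _ := (mul_comm _ _).trans C.H.m0q
  simp only [Qv, Uv, Vv] at e hg
  have key : ∃ c : F, (2 * (α - 4 * b) ^ 2 * (α - 2 * b) ^ 2) • (q * s) -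
    (((α - 4 * b) * (α - 2 * b) ^ 2) • ((8 * b * (α - 2 * b) ^ 2) • p
      + (2 * Mm α b l' l * (α - 2 * b)) • (s + b • (a0 + a2)) + K2h α b l' l • (a1 + a3))
    + ((α - 4 * b) ^ 2 * (α - 2 * b) ^ 2 * (2 * α * (l - 2 * b))) • q
    + (2 * (α - 4 * b) ^ 2 * (α - 2 * b) ^ 2 * k * α) • (s + b • (a1 + a3))
    - ((α - 2 * b)^2 * 8 * b * (α - 2 * b)) • ((4 * b * (α - 2 * b)) • q + Mm α b l l' • (s + b • (a1 + a3)))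
    - (2 * Mm α b l' l * (α - 4 * b) * (α - 2 * b) ^ 2) • ((α - 2 * b) • (s + b • (a1 + a3)) + b • q)
    - (2 * (α - 4 * b) * (α - 2 * b) * K2h α b l' l) • (s + b • (a1 + a3))) = c • a0 := by
    apply of_mkQ
    have z0 := mkQ_self (F := F) a0
    simp only [mul_add, add_mul, mul_sub, sub_mul, mul_smul_comm, smul_mul_assoc,
      C.H.i0, C.H.m01, C.H.m03, C.H.m0s, C.H.m02, qa0, C.H.m0q, smul_add, smul_sub] at e hg hB hBa
    apply_fun (Submodule.span F {a0}).mkQ at e hg hB hBa h0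
    simp only [map_add, map_sub, map_smul, z0, map_zero, smul_zero] at e hg hB hBa h0 ⊢
    refine cancel (c := α) C.hα ?_
    linear_combination (norm := skip) ((α - 4 * b) ^ 2 * (α - 2 * b) ^ 2) • (e + (2 : F) • hg)
      + (α * (α - 4 * b) * (α - 2 * b) ^ 2) • hB - (α * (α - 4 * b) * (α - 2 * b)) • hBa
      - (8 * α * b * (α - 2 * b) ^ 2) • h0
    clear e hg hB hBa h0 h1 h3
    match_scalars <;> ring
  obtain ⟨c, hc⟩ := key
  have c0 := C.H.ind (-((α - 4 * b) * (α - 2 * b) ^ 2 * (2 * Mm α b l' l * (α - 2 * b)) * b))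
    (-((α - 4 * b) * (α - 2 * b) ^ 2 * K2h α b l' l + 2 * (α - 4 * b) ^ 2 * (α - 2 * b) ^ 2 * k * α * b
      - 8 * b * (α - 2 * b) ^ 3 * Mm α b l l' * b
      - 2 * Mm α b l' l * (α - 4 * b) * (α - 2 * b) ^ 3 * b
      - 2 * (α - 4 * b) * (α - 2 * b) * K2h α b l' l * b))
    (-((α - 4 * b) * (α - 2 * b) ^ 2 * (2 * Mm α b l' l * (α - 2 * b))
      + 2 * (α - 4 * b) ^ 2 * (α - 2 * b) ^ 2 * k * α
      - 8 * b * (α - 2 * b) ^ 3 * Mm α b l l'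
      - 2 * Mm α b l' l * (α - 4 * b) * (α - 2 * b) ^ 3
      - 2 * (α - 4 * b) * (α - 2 * b) * K2h α b l' l))
    (-((α - 4 * b) * (α - 2 * b) ^ 2 * (8 * b * (α - 2 * b) ^ 2)))
    (-((α - 4 * b) ^ 2 * (α - 2 * b) ^ 2 * (2 * α * (l - 2 * b))
      - 8 * b * (α - 2 * b) ^ 3 * (4 * b * (α - 2 * b))
      - 2 * Mm α b l' l * (α - 4 * b) * (α - 2 * b) ^ 2 * b)) 0 0
    (2 * (α - 4 * b) ^ 2 * (α - 2 * b) ^ 2) c (by rw [← hc]; module)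
  rw [c0, zero_smul, sub_eq_zero] at hc
  exact hc

/-- the submodule of the square of `V` spanned by the symmetrised generators -/
def Ysub (F : Type u) [Field F] {V : Type v} [NonUnitalNonAssocCommRing V]
  [Module F V] (a0 a1 a2 a3 s p q : V) : Submodule F (V × V) :=
  Submodule.span F {(a0, a1), (a1, a0), (a2, a3), (a3, a2), (s, s), (q, p)}

theorem Ctx.Y_mul (C : Ctx α b l l k k a0 a1 a2 a3 s p q φ φ') {x y : V × V}
    (hx : x ∈ Ysub F a0 a1 a2 a3 s p q) (hy : y ∈ Ysub F a0 a1 a2 a3 s p q) :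
    x * y ∈ Ysub F a0 a1 a2 a3 s p q := by
  have g0 : (a0, a1) ∈ Ysub F a0 a1 a2 a3 s p q := Submodule.subset_span (by simp)
  have g1 : (a1, a0) ∈ Ysub F a0 a1 a2 a3 s p q := Submodule.subset_span (by simp)
  have g2 : (a2, a3) ∈ Ysub F a0 a1 a2 a3 s p q := Submodule.subset_span (by simp)
  have g3 : (a3, a2) ∈ Ysub F a0 a1 a2 a3 s p q := Submodule.subset_span (by simp)
  have gs : (s, s) ∈ Ysub F a0 a1 a2 a3 s p q := Submodule.subset_span (by simp)
  have gq : (q, p) ∈ Ysub F a0 a1 a2 a3 s p q := Submodule.subset_span (by simp)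
  -- scaling
  have sc : ∀ {c : F} {z : V × V}, c ≠ 0 → c • z ∈ Ysub F a0 a1 a2 a3 s p q →
      z ∈ Ysub F a0 a1 a2 a3 s p q := by
    intro c z hc h
    have := Submodule.smul_mem _ c⁻¹ h
    rwa [smul_smul, inv_mul_cancel₀ hc, one_smul] at this
  -- linear combinations
  have comb : ∀ (x0 x1 x2 x3 y z w : F), (p, q) ∈ Ysub F a0 a1 a2 a3 s p q →
      x0 • (a0, a1) + x1 • (a1, a0) + x2 • (a2, a3) + x3 • (a3, a2) + y • (s, s) + z • (q, p)
        + w • (p, q) ∈ Ysub F a0 a1 a2 a3 s p q := by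
    intro x0 x1 x2 x3 y z w gp
    exact add_mem (add_mem (add_mem (add_mem (add_mem (add_mem (Submodule.smul_mem _ _ g0)
      (Submodule.smul_mem _ _ g1)) (Submodule.smul_mem _ _ g2)) (Submodule.smul_mem _ _ g3))
      (Submodule.smul_mem _ _ gs)) (Submodule.smul_mem _ _ gq)) (Submodule.smul_mem _ _ gp)
  have gp : (p, q) ∈ Ysub F a0 a1 a2 a3 s p q := by
    have R := C.R3
    have D0 : Dd α b l l = 0 := by simp only [Dd]; ring
    rw [D0] at R
    refine sc C.T0 ?_
    have : Tt α b • (p, q) = Tt α b • (q, p) + XX α b l l • (a0, a1) + XX α b l l • (a2, a3)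
       - XX α b l l • (a1, a0) - XX α b l l • (a3, a2) := by
      ext
      · simp
        linear_combination (norm := module) R
      · simp
        linear_combination (norm := module) -R
    rw [this]
    exact sub_mem (sub_mem (add_mem (add_mem (Submodule.smul_mem _ _ gq)
      (Submodule.smul_mem _ _ g0)) (Submodule.smul_mem _ _ g2)) (Submodule.smul_mem _ _ g1))
      (Submodule.smul_mem _ _ g3)
  have E : ∀ {u1 u2 v1 v2 : V} (c x0 x1 x2 x3 y u w : F), c ≠ 0 →
      c • (u1 * v1) = x0 • a0 + x1 • a1 + x2 • a2 + x3 • a3 + y • s + u • q + w • p →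
      c • (u2 * v2) = x0 • a1 + x1 • a0 + x2 • a3 + x3 • a2 + y • s + u • p + w • q →
      (u1, u2) * (v1, v2) ∈ Ysub F a0 a1 a2 a3 s p q := by
    intro u1 u2 v1 v2 c x0 x1 x2 x3 y u w hc h1 h2
    refine sc hc ?_
    convert comb x0 x1 x2 x3 y u w gp using 1
    ext
    · simp [h1]
    · simp [h2]
  have ED : (α - 4 * b) * (α - 2 * b) ≠ 0 := mul_ne_zero C.hε C.hδ
  have E4 : 4 * (α - 4 * b) ≠ 0 := by
    have : 4 * (α - 4 * b) = 2 * 2 * (α - 4 * b) := by ring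
    rw [this]; exact mul_ne_zero (mul_ne_zero C.h2 C.h2) C.hε
  have EQ : 2 * (α - 4 * b) ^ 2 * (α - 2 * b) ^ 2 ≠ 0 :=
    mul_ne_zero (mul_ne_zero C.h2 (pow_ne_zero 2 C.hε)) (pow_ne_zero 2 C.hδ)
  have m00 : (a0, a1) * (a0, a1) ∈ Ysub F a0 a1 a2 a3 s p q := by
    refine E (1) (1) (0) (0) (0) (0) (0) (0) one_ne_zero ?_ ?_
    · linear_combination (norm := module) C.H.i0
    · linear_combination (norm := module) C.H'.i0
  have m01 : (a0, a1) * (a1, a0) ∈ Ysub F a0 a1 a2 a3 s p q := by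
    refine E (1) (2 * b) (2 * b) (0) (0) (1) (0) (0) one_ne_zero ?_ ?_
    · linear_combination (norm := module) C.H.m01
    · linear_combination (norm := module) C.H'.m01
  have m02 : (a0, a1) * (a2, a3) ∈ Ysub F a0 a1 a2 a3 s p q := by
    refine E (1) (0) (0) (0) (0) (0) (1) (0) one_ne_zero ?_ ?_
    · linear_combination (norm := module) C.H.m02
    · linear_combination (norm := module) C.H'.m02
  have m03 : (a0, a1) * (a3, a2) ∈ Ysub F a0 a1 a2 a3 s p q := by
    refine E (1) (2 * b) (0) (0) (2 * b) (1) (0) (0) one_ne_zero ?_ ?_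
    · linear_combination (norm := module) C.H.m03
    · linear_combination (norm := module) C.H'.m03
  have m0s : (a0, a1) * (s, s) ∈ Ysub F a0 a1 a2 a3 s p q := by
    refine E (1) (mu α b l) ((α - 2 * b) * b) (0) ((α - 2 * b) * b) (α - 2 * b) (0) (0) one_ne_zero ?_ ?_
    · linear_combination (norm := module) C.H.m0s
    · linear_combination (norm := module) C.H'.m0s
  have m0q : (a0, a1) * (q, p) ∈ Ysub F a0 a1 a2 a3 s p q := by
    refine E (1) ((1 - α) * k) (0) (0) (0) (0) (α) (0) one_ne_zero ?_ ?_
    · linear_combination (norm := module) C.H.m0q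
    · linear_combination (norm := module) C.H'.m0q
  have m11 : (a1, a0) * (a1, a0) ∈ Ysub F a0 a1 a2 a3 s p q := by
    refine E (1) (0) (1) (0) (0) (0) (0) (0) one_ne_zero ?_ ?_
    · linear_combination (norm := module) C.H'.i0
    · linear_combination (norm := module) C.H.i0
  have m12 : (a1, a0) * (a2, a3) ∈ Ysub F a0 a1 a2 a3 s p q := by
    refine E (1) (0) (2 * b) (2 * b) (0) (1) (0) (0) one_ne_zero ?_ ?_
    · linear_combination (norm := module) C.H'.m03
    · linear_combination (norm := module) C.H.m03
  have m13 : (a1, a0) * (a3, a2) ∈ Ysub F a0 a1 a2 a3 s p q := by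
    refine E (1) (0) (0) (0) (0) (0) (0) (1) one_ne_zero ?_ ?_
    · linear_combination (norm := module) C.H'.m02
    · linear_combination (norm := module) C.H.m02
  have m1s : (a1, a0) * (s, s) ∈ Ysub F a0 a1 a2 a3 s p q := by
    refine E (1) ((α - 2 * b) * b) (mu α b l) ((α - 2 * b) * b) (0) (α - 2 * b) (0) (0) one_ne_zero ?_ ?_
    · linear_combination (norm := module) C.H'.m0s
    · linear_combination (norm := module) C.H.m0s
  have m1q : (a1, a0) * (q, p) ∈ Ysub F a0 a1 a2 a3 s p q := by
    refine E ((α - 4 * b) * (α - 2 * b)) ((α - 2 * b) * Mm α b l l * b) (K2h α b l l) ((α - 2 * b) * Mm α b l l * b) (0) ((α - 2 * b) * Mm α b l l) (0) ((α - 2 * b) * (4 * b * (α - 2 * b))) ED ?_ ?_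
    · linear_combination (norm := module) C.flip.a0p
    · linear_combination (norm := module) C.a0p
  have m22 : (a2, a3) * (a2, a3) ∈ Ysub F a0 a1 a2 a3 s p q := by
    refine E (1) (0) (0) (1) (0) (0) (0) (0) one_ne_zero ?_ ?_
    · linear_combination (norm := module) C.H.i2
    · linear_combination (norm := module) C.H'.i2
  have m23 : (a2, a3) * (a3, a2) ∈ Ysub F a0 a1 a2 a3 s p q := by
    refine E (1) (0) (0) (2 * b) (2 * b) (1) (0) (0) one_ne_zero ?_ ?_
    · linear_combination (norm := module) C.H.m23
    · linear_combination (norm := module) C.H'.m23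
  have m2s : (a2, a3) * (s, s) ∈ Ysub F a0 a1 a2 a3 s p q := by
    refine E (1) (0) ((α - 2 * b) * b) (mu α b l) ((α - 2 * b) * b) (α - 2 * b) (0) (0) one_ne_zero ?_ ?_
    · linear_combination (norm := module) C.H.m2s
    · linear_combination (norm := module) C.H'.m2s
  have m2q : (a2, a3) * (q, p) ∈ Ysub F a0 a1 a2 a3 s p q := by
    refine E (1) (0) (0) ((1 - α) * k) (0) (0) (α) (0) one_ne_zero ?_ ?_
    · linear_combination (norm := module) C.H.m2q
    · linear_combination (norm := module) C.H'.m2q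
  have m33 : (a3, a2) * (a3, a2) ∈ Ysub F a0 a1 a2 a3 s p q := by
    refine E (1) (0) (0) (0) (1) (0) (0) (0) one_ne_zero ?_ ?_
    · linear_combination (norm := module) C.H'.i2
    · linear_combination (norm := module) C.H.i2
  have m3s : (a3, a2) * (s, s) ∈ Ysub F a0 a1 a2 a3 s p q := by
    refine E (1) ((α - 2 * b) * b) (0) ((α - 2 * b) * b) (mu α b l) (α - 2 * b) (0) (0) one_ne_zero ?_ ?_
    · linear_combination (norm := module) C.H'.m2s
    · linear_combination (norm := module) C.H.m2s
  have m3q : (a3, a2) * (q, p) ∈ Ysub F a0 a1 a2 a3 s p q := by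
    refine E ((α - 4 * b) * (α - 2 * b)) ((α - 2 * b) * Mm α b l l * b) (0) ((α - 2 * b) * Mm α b l l * b) (K2h α b l l) ((α - 2 * b) * Mm α b l l) (0) ((α - 2 * b) * (4 * b * (α - 2 * b))) ED ?_ ?_
    · linear_combination (norm := module) C.flip.a2p
    · linear_combination (norm := module) C.a2p
  have mss : (s, s) * (s, s) ∈ Ysub F a0 a1 a2 a3 s p q := by
    refine E (4 * (α - 4 * b)) (4 * b * (α - 4 * b) ^ 2 * (α - 2 * b)) (K2B α b l l) (4 * b * (α - 4 * b) ^ 2 * (α - 2 * b)) (K2B α b l l) (K2S α b l l) (-(4 * b * α * (α - 2 * b))) (4 * b * (α - 4 * b) * (α - 2 * b)) E4 ?_ ?_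
    · linear_combination (norm := module) (K2 C.h2 C.hα C.H C.H').1
    · linear_combination (norm := module) (K2 C.h2 C.hα C.H' C.H).1
  have mqs : (q, p) * (s, s) ∈ Ysub F a0 a1 a2 a3 s p q := by
    refine E (2 * (α - 4 * b) ^ 2 * (α - 2 * b) ^ 2) ((α - 4 * b) * (α - 2 * b) ^ 2 * (2 * Mm α b l l * (α - 2 * b)) * b) ((α - 4 * b) * (α - 2 * b) ^ 2 * K2h α b l l + 2 * (α - 4 * b) ^ 2 * (α - 2 * b) ^ 2 * k * α * b - 8 * b * (α - 2 * b) ^ 3 * Mm α b l l * b - 2 * Mm α b l l * (α - 4 * b) * (α - 2 * b) ^ 3 * b - 2 * (α - 4 * b) * (α - 2 * b) * K2h α b l l * b) ((α - 4 * b) * (α - 2 * b) ^ 2 * (2 * Mm α b l l * (α - 2 * b)) * b) ((α - 4 * b) * (α - 2 * b) ^ 2 * K2h α b l l + 2 * (α - 4 * b) ^ 2 * (α - 2 * b) ^ 2 * k * α * b - 8 * b * (α - 2 * b) ^ 3 * Mm α b l l * b - 2 * Mm α b l l * (α - 4 * b) * (α - 2 * b) ^ 3 * b - 2 * (α - 4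 * b) * (α - 2 * b) * K2h α b l l * b) ((α - 4 * b) * (α - 2 * b) ^ 2 * (2 * Mm α b l l * (α - 2 * b)) + 2 * (α - 4 * b) ^ 2 * (α - 2 * b) ^ 2 * k * α - 8 * b * (α - 2 * b) ^ 3 * Mm α b l l - 2 * Mm α b l l * (α - 4 * b) * (α - 2 * b) ^ 3 - 2 * (α - 4 * b) * (α - 2 * b) * K2h α b l l) ((α - 4 * b) ^ 2 * (α - 2 * b) ^ 2 * (2 * α * (l - 2 * b)) - 8 * b * (α - 2 * b) ^ 3 * (4 * b * (α - 2 * b)) - 2 * Mm α b l l * (α - 4 * b) * (α - 2 * b) ^ 2 * b) ((α - 4 * b) * (α - 2 * b) ^ 2 * (8 * b * (α - 2 * b) ^ 2)) EQ ?_ ?_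
    · linear_combination (norm := module) C.qs
    · linear_combination (norm := module) C.flip.qs
  have mqq : (q, p) * (q, p) ∈ Ysub F a0 a1 a2 a3 s p q := by
    refine E (1) (α * (1 - α) * k) (0) (α * (1 - α) * k) (0) (0) (2 * α ^ 2 + (1 - α) * k - α) (0) one_ne_zero ?_ ?_
    · linear_combination (norm := module) C.qq
    · linear_combination (norm := module) C.flip.qq
  have S : ∀ {x y : V × V}, x * y ∈ Ysub F a0 a1 a2 a3 s p q → y * x ∈ Ysub F a0 a1 a2 a3 s p q := by
    intro x y h
    rwa [mul_comm]
  refine Submodule.span_induction₂ (p := fun x y _ _ => x * y ∈ Ysub F a0 a1 a2 a3 s p q)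
    ?_ ?_ ?_ ?_ ?_ ?_ ?_ hx hy
  · intro x y hx hy
    simp only [Set.mem_insert_iff, Set.mem_singleton_iff] at hx hy
    rcases hx with rfl | rfl | rfl | rfl | rfl | rfl
    · rcases hy with rfl | rfl | rfl | rfl | rfl | rfl
      exacts [m00, m01, m02, m03, m0s, m0q]
    · rcases hy with rfl | rfl | rfl | rfl | rfl | rfl
      exacts [S m01, m11, m12, m13, m1s, m1q]
    · rcases hy with rfl | rfl | rfl | rfl | rfl | rfl
      exacts [S m02, S m12, m22, m23, m2s, m2q]
    · rcases hy with rfl | rfl | rfl | rfl | rfl | rfl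
      exacts [S m03, S m13, S m23, m33, m3s, m3q]
    · rcases hy with rfl | rfl | rfl | rfl | rfl | rfl
      exacts [S m0s, S m1s, S m2s, S m3s, mss, S mqs]
    · rcases hy with rfl | rfl | rfl | rfl | rfl | rfl
      exacts [S m0q, S m1q, S m2q, S m3q, mqs, mqq]
  · intro y _; rw [zero_mul]; exact zero_mem _
  · intro y _; rw [mul_zero]; exact zero_mem _
  · intro x y z _ _ _ h1 h2; rw [add_mul]; exact add_mem h1 h2
  · intro x y z _ _ _ h1 h2; rw [mul_add]; exact add_mem h1 h2
  · intro r x y _ _ h; rw [smul_mul_assoc]; exact Submodule.smul_mem _ _ h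
  · intro r x y _ _ h; rw [mul_smul_comm]; exact Submodule.smul_mem _ _ h

theorem Ctx.Y_phi (C : Ctx α b l l k k a0 a1 a2 a3 s p q φ φ') {x : V × V}
    (hx : x ∈ Ysub F a0 a1 a2 a3 s p q) : φ x.1 = φ' x.2 := by
  induction hx using Submodule.span_induction with
  | mem x h =>
    simp only [Set.mem_insert_iff, Set.mem_singleton_iff] at h
    rcases h with rfl | rfl | rfl | rfl | rfl | rfl <;>
    simp only [C.H.φ0, C.H.φ1, C.H.φ2, C.H.φ3, C.H.φs, C.H.φq, C.H'.φ0, C.H'.φ1, C.H'.φ2,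
      C.H'.φ3, C.H'.φs, C.H'.φq]
  | zero => simp
  | add x y _ _ h1 h2 => simp [h1, h2]
  | smul c x _ h => simp [h]

end tb8

section tb9
variable {F : Type u} [Field F] {V : Type v} [NonUnitalNonAssocCommRing V]
  [Module F V] [SMulCommClass F V V] [IsScalarTower F V V]
variable {α β b : F} {a a0 a1 : V}

theorem mem_eig {a x : V} {μ : F} : x ∈ eigSp F a μ ↔ a * x = μ • x := Iff.rfl

theorem IsAxis.dec (A : IsAxis F α β a) (x : V) : ∃ (c : F) (z y w : V),
    x = c • a + z + y + w ∧ a * z = 0 ∧ a * y = α • y ∧ a * w = β • w := by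
  have hx : x ∈ eigSp F a 1 ⊔ eigSp F a 0 ⊔ eigSp F a α ⊔ eigSp F a β := by
    rw [A.decomp]; trivial
  rw [A.primitive, Submodule.mem_sup] at hx
  obtain ⟨x3, hx3, w, hw, rfl⟩ := hx
  obtain ⟨x2, hx2, y, hy, rfl⟩ := Submodule.mem_sup.1 hx3
  obtain ⟨x1, hx1, z, hz, rfl⟩ := Submodule.mem_sup.1 hx2
  obtain ⟨c, rfl⟩ := Submodule.mem_span_singleton.1 hx1
  refine ⟨c, z, y, w, rfl, ?_, hy, hw⟩
  have := mem_eig.1 hz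
  rwa [zero_smul] at this

theorem IsAxis.phi (A : IsAxis F α β a) (h0 : a ≠ 0) (hα1 : 1 - α ≠ 0) (hβ1 : 1 - β ≠ 0) :
    ∃ φ : V →ₗ[F] F, ∀ (c : F) (z y w : V), a * z = 0 → a * y = α • y → a * w = β • w →
      φ (c • a + z + y + w) = c := by
  obtain ⟨ψ, hψ⟩ := LinearMap.exists_leftInverse_of_injective (LinearMap.toSpanSingleton F V a)
    (LinearMap.ker_toSpanSingleton F h0)
  have hψa : ψ a = 1 := by
    have := LinearMap.congr_fun hψ 1
    simpa using this
  let L : V →ₗ[F] V := LinearMap.mulLeft F a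
  have hL : ∀ x, L x = a * x := fun x => rfl
  let P : V →ₗ[F] V := L ∘ₗ (L - α • LinearMap.id) ∘ₗ (L - β • LinearMap.id)
  refine ⟨((1 - α) * (1 - β))⁻¹ • (ψ ∘ₗ P), fun c z y w hz hy hw => ?_⟩
  have hP : P (c • a + z + y + w) = (c * ((1 - α) * (1 - β))) • a := by
    simp only [P, LinearMap.comp_apply, LinearMap.sub_apply, LinearMap.smul_apply,
      LinearMap.id_apply, hL, mul_add, mul_sub, mul_smul_comm, A.idem, hz, hy, hw, mul_zero,
      smul_zero]
    module
  rw [LinearMap.smul_apply, LinearMap.comp_apply, hP, map_smul, hψa, smul_eq_mul, smul_eq_mul]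
  field_simp

theorem IsMiyamoto.self {τ : V ≃ₗ[F] V} (A : IsAxis F α β a) (T : IsMiyamoto F α β a τ) :
    τ a = a := by
  apply T.fix_plus
  apply Submodule.mem_sup_left
  apply Submodule.mem_sup_left
  rw [mem_eig, one_smul, A.idem]

theorem IsMiyamoto.app {τ : V ≃ₗ[F] V} (A : IsAxis F α β a) (T : IsMiyamoto F α β a τ)
    (c : F) {z y w : V} (hz : a * z = 0) (hy : a * y = α • y) (hw : a * w = β • w) :
    τ (c • a + z + y + w) = c • a + z + y - w := by
  rw [map_add, T.neg_beta w hw, T.fix_plus, sub_eq_add_neg]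
  refine Submodule.add_mem_sup (Submodule.add_mem_sup ?_ ?_) hy
  · rw [mem_eig, one_smul, mul_smul_comm, A.idem]
  · rw [mem_eig, zero_smul, hz]

theorem IsMiyamoto.invol {τ : V ≃ₗ[F] V} (A : IsAxis F α β a) (T : IsMiyamoto F α β a τ)
    (x : V) : τ (τ x) = x := by
  obtain ⟨c, z, y, w, rfl, hz, hy, hw⟩ := A.dec x
  rw [T.app A c hz hy hw, sub_eq_add_neg, T.app A c hz hy (by rw [mul_neg, hw, smul_neg])]
  abel

theorem IsMiyamoto.fix_s {τ : V ≃ₗ[F] V} (A : IsAxis F α β a) (T : IsMiyamoto F α β a τ)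
    (x : V) : τ (a * x - β • (a + x)) = a * x - β • (a + x) := by
  obtain ⟨c, z, y, w, rfl, hz, hy, hw⟩ := A.dec x
  have h : a * (c • a + z + y + w) - β • (a + (c • a + z + y + w)) =
      (c - β - β * c) • a + (-β) • z + (α - β) • y + (0 : V) := by
    simp only [mul_add, mul_smul_comm, A.idem, hz, hy, hw]
    module
  rw [h, T.app A _ (by rw [mul_smul_comm, hz, smul_zero])
    (by rw [mul_smul_comm, hy, smul_comm]) (by simp)]
  abel

theorem IsAxis.mul_aa (A : IsAxis F α β a) {x y : V} (hx : a * x = α • x) (hy : a * y = α • y) :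
    ∃ g : F, a * (x * y) = g • a := by
  have h := A.fusion_alpha_alpha x hx y hy
  rw [A.primitive, Submodule.mem_sup] at h
  obtain ⟨u, hu, z, hz, h⟩ := h
  obtain ⟨c, rfl⟩ := Submodule.mem_span_singleton.1 hu
  refine ⟨c, ?_⟩
  rw [mem_eig, zero_smul] at hz
  rw [← h, mul_add, hz, mul_smul_comm, A.idem, add_zero]

theorem side_of (h2 : (2 : F) ≠ 0) (hα1 : 1 - α ≠ 0) (hβ1 : 1 - 2 * b ≠ 0)
    {τ0 τ1 : V ≃ₗ[F] V} (A0 : IsAxis F α (2 * b) a0) (A1 : IsAxis F α (2 * b) a1)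
    (T0 : IsMiyamoto F α (2 * b) a0 τ0) (T1 : IsMiyamoto F α (2 * b) a1 τ1)
    (ne : τ1 a0 ≠ a0) (h02 : τ0 (τ1 a0) = τ1 a0) (h13 : τ1 (τ0 a1) = τ0 a1) :
    ∃ (φ : V →ₗ[F] F) (l k : F), Side α b a0 a1 (τ1 a0) (τ0 a1)
      (a0 * a1 - (2 * b) • (a0 + a1)) (a1 * τ0 a1) (a0 * τ1 a0) l k φ := by
  have h00 : a0 ≠ 0 := by
    rintro rfl
    exact ne (map_zero _)
  obtain ⟨φ, hφ⟩ := A0.phi h00 hα1 hβ1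
  obtain ⟨l, z, y, w, e1, hz, hy, hw⟩ := A0.dec a1
  obtain ⟨k, z', y', w', e2, hz', hy', hw'⟩ := A0.dec (τ1 a0)
  have e3 : τ0 a1 = l • a0 + z + y - w := by rw [e1, T0.app A0 l hz hy hw]
  have hw0 : w' = 0 := by
    have h := h02
    rw [e2, T0.app A0 k hz' hy' hw'] at h
    have h3 : (2 : F) • w' = (2 : F) • (0 : V) := by
      linear_combination (norm := module) -h
    exact cancel h2 h3
  subst hw0
  have hs0 := T0.fix_s A0 a1
  have hs1 := T1.fix_s A1 a0
  rw [mul_comm a1 a0, add_comm a1 a0] at hs1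
  have t0 := T0.self A0
  have t1 := T1.self A1
  have t10 := T1.invol A1 a0
  generalize ha2 : τ1 a0 = a2 at *
  generalize ha3 : τ0 a1 = a3 at *
  generalize hs : a0 * a1 - (2 * b) • (a0 + a1) = s at *
  generalize hq : a0 * a2 = q
  generalize hp : a1 * a3 = p
  have φ0 : φ a0 = 1 := by simpa using hφ 1 0 0 0 (by simp) (by simp) (by simp)
  have φm : ∀ x, φ (a0 * x) = φ x := by
    intro x
    obtain ⟨c, z, y, w, rfl, hz, hy, hw⟩ := A0.dec x
    rw [hφ c z y w hz hy hw]
    have h : a0 * (c • a0 + z + y + w) = c • a0 + 0 + α • y + (2 * b) • w := by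
      simp only [mul_add, mul_smul_comm, A0.idem, hz, hy, hw]
    rw [h, hφ c _ _ _ (mul_zero _) (by rw [mul_smul_comm, hy]) (by rw [mul_smul_comm, hw])]
  have φ1 : φ a1 = l := by rw [e1, hφ l z y w hz hy hw]
  have φ3 : φ a3 = l := by
    rw [e3, sub_eq_add_neg, hφ l z y (-w) hz hy (by rw [mul_neg, hw, smul_neg])]
  have φ2 : φ a2 = k := by rw [e2, hφ k z' y' 0 hz' hy' hw']
  have es : s = (l - 2 * b - 2 * b * l) • a0 + (-(2 * b)) • z + (α - 2 * b) • y := by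
    rw [← hs, e1]
    simp only [mul_add, mul_smul_comm, A0.idem, hz, hy, hw]
    module
  have eq : q = k • a0 + α • y' := by
    rw [← hq, e2]
    simp only [mul_add, mul_smul_comm, A0.idem, hz', hy', hw', mul_zero]
    module
  have eU : Uv α b l a0 a1 a3 s = (2 * α) • z := by
    rw [Uv, e1, e3, es]; module
  have eV : Vv b l a0 a1 a3 s = α • y := by
    rw [Vv, e1, e3, es]; module
  have eQ : Qv k a0 q = α • y' := by
    rw [Qv, eq]; module
  have eX : Xv α k a0 a2 q = α • z' := by
    rw [Xv, e2, eq]; module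
  have m01 : a0 * a1 = s + (2 * b) • (a0 + a1) := by rw [← hs]; abel
  have m03 : a0 * a3 = s + (2 * b) • (a0 + a3) := by
    have h := congrArg τ0 m01
    rwa [T0.map_mul, map_add, map_smul, map_add, t0, ha3, hs0] at h
  have m0s : a0 * s = mu α b l • a0 + (α - 2 * b) • (s + b • (a1 + a3)) := by
    have h : a0 * s = (l - 2 * b - 2 * b * l) • a0 + (α - 2 * b) • α • y := by
      rw [es]
      simp only [mul_add, mul_smul_comm, A0.idem, hz, hy, hw, smul_zero]
      module
    rw [h, e1, e3, es, mu]
    module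
  have m0q : a0 * q = α • q + ((1 - α) * k) • a0 := by
    rw [eq]
    simp only [mul_add, mul_smul_comm, A0.idem, hy']
    module
  have hzm : z ∈ eigSp F a0 0 := by rw [mem_eig, hz, zero_smul]
  have hzm' : z' ∈ eigSp F a0 0 := by rw [mem_eig, hz', zero_smul]
  have tq : τ1 q = q := by rw [← hq, T1.map_mul, ha2, t10, mul_comm]
  refine ⟨φ, l, k, ⟨A0.idem, ?_, m01, m03, ?_, ?_, hq, m0s, ?_, m0q, ?_, φ0, φm, φ1, φ3, φ2, hp,
    fun h => ne h.symm, ⟨τ1.toLinearMap, T1.map_mul, ha2, t10, t1, h13⟩, ?_, ?_, ?_, ?_, ?_, ?_,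
    ?_, ?_⟩⟩
  · rw [← ha2, ← T1.map_mul, A0.idem]
  · have h := congrArg τ1 m01
    rwa [T1.map_mul, map_add, map_smul, map_add, t1, ha2, hs1] at h
  · have h := congrArg τ1 m03
    rwa [T1.map_mul, map_add, map_smul, map_add, h13, ha2, hs1] at h
  · have h := congrArg τ1 m0s
    rwa [T1.map_mul, map_add, map_smul, map_smul, map_add, map_smul, map_add, t1, h13, ha2, hs1]
      at h
  · have h := congrArg τ1 m0q
    rwa [T1.map_mul, map_add, map_smul, map_smul, tq, ha2] at h
  · rw [eU]
    have h := mem_eig.1 (A0.fusion_zero_zero z hzm z hzm)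
    simp only [mul_smul_comm, smul_mul_assoc, h, zero_smul, smul_zero]
  · rw [eU, eV]
    have h := mem_eig.1 (A0.fusion_zero_alpha z hzm y hy)
    simp only [mul_smul_comm, smul_mul_assoc, h]
    module
  · rw [eV]
    exact A0.mul_aa (by rw [mul_smul_comm, hy]) (by rw [mul_smul_comm, hy])
  · rw [eQ, eX]
    have h := mem_eig.1 (A0.fusion_zero_alpha z' hzm' y' hy')
    rw [mul_comm z' y'] at h
    simp only [mul_smul_comm, smul_mul_assoc, h]
  · rw [eX]
    have h := mem_eig.1 (A0.fusion_zero_zero z' hzm' z' hzm')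
    simp only [mul_smul_comm, smul_mul_assoc, h, zero_smul, smul_zero]
  · rw [eQ]
    exact A0.mul_aa (by rw [mul_smul_comm, hy']) (by rw [mul_smul_comm, hy'])
  · rw [eQ, eU]
    have h := mem_eig.1 (A0.fusion_zero_alpha z hzm y' hy')
    rw [mul_comm z y'] at h
    simp only [mul_smul_comm, smul_mul_assoc, h]
    module
  · rw [eQ, eV]
    exact A0.mul_aa (by rw [mul_smul_comm, hy']) (by rw [mul_smul_comm, hy])

theorem orbit_sub {τ0 τ1 : V ≃ₗ[F] V} {x : V} (S : Set V) (hx : x ∈ S)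
    (i0 : ∀ v, τ0 (τ0 v) = v) (i1 : ∀ v, τ1 (τ1 v) = v)
    (h0 : ∀ v ∈ S, τ0 v ∈ S) (h1 : ∀ v ∈ S, τ1 v ∈ S) : miyOrbit F τ0 τ1 x ⊆ S := by
  rintro w ⟨g, hg, rfl⟩
  have key : ∀ v ∈ S, g v ∈ S := by
    induction hg using Subgroup.closure_induction_left with
    | one => exact fun v hv => hv
    | mul_left t ht g hg ih =>
      intro v hv
      rcases ht with rfl | rfl
      · exact h0 _ (ih v hv)
      · exact h1 _ (ih v hv)
    | inv_mul_cancel t ht g hg ih =>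
      intro v hv
      rcases ht with rfl | rfl
      · have e : (t⁻¹ * g) v = t (g v) := by
          apply t.injective
          rw [i0]
          change (t * (t⁻¹ * g)) v = g v
          rw [mul_inv_cancel_left]
        rw [e]; exact h0 _ (ih v hv)
      · have e : (t⁻¹ * g) v = t (g v) := by
          apply t.injective
          rw [i1]
          change (t * (t⁻¹ * g)) v = g v
          rw [mul_inv_cancel_left]
        rw [e]; exact h1 _ (ih v hv)
  exact key x hx

theorem orbit_facts {τ0 τ1 : V ≃ₗ[F] V} {x : V} (hx : τ0 x = x)
    (i0 : ∀ v, τ0 (τ0 v) = v) (i1 : ∀ v, τ1 (τ1 v) = v)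
    (hn : (miyOrbit F τ0 τ1 x).ncard = 2) : τ1 x ≠ x ∧ τ0 (τ1 x) = τ1 x := by
  have g0 : τ0 ∈ Subgroup.closure ({τ0, τ1} : Set (V ≃ₗ[F] V)) :=
    Subgroup.subset_closure (by simp)
  have g1 : τ1 ∈ Subgroup.closure ({τ0, τ1} : Set (V ≃ₗ[F] V)) :=
    Subgroup.subset_closure (by simp)
  have ne : τ1 x ≠ x := by
    intro h
    have hs : miyOrbit F τ0 τ1 x ⊆ {x} := by
      apply orbit_sub {x} (Set.mem_singleton x) i0 i1
      · rintro v rfl; exact hx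
      · rintro v rfl; exact h
    have := Set.ncard_le_ncard hs (Set.finite_singleton x)
    rw [hn, Set.ncard_singleton] at this
    omega
  refine ⟨ne, ?_⟩
  have m0 : x ∈ miyOrbit F τ0 τ1 x := ⟨1, one_mem _, rfl⟩
  have m1 : τ1 x ∈ miyOrbit F τ0 τ1 x := ⟨τ1, g1, rfl⟩
  have m2 : τ0 (τ1 x) ∈ miyOrbit F τ0 τ1 x := ⟨τ0 * τ1, mul_mem g0 g1, rfl⟩
  have hf : (miyOrbit F τ0 τ1 x).Finite := Set.finite_of_ncard_ne_zero (by omega)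
  have he : ({x, τ1 x} : Set V) = miyOrbit F τ0 τ1 x := by
    apply Set.eq_of_subset_of_ncard_le _ _ hf
    · rintro v (rfl | rfl)
      · exact m0
      · exact m1
    · rw [hn, Set.ncard_pair ne.symm]
  rw [← he] at m2
  rcases m2 with h | h
  · exfalso
    apply ne
    have := congrArg τ0 h
    rwa [i0, hx] at this
  · exact h

theorem orbit_comm (τ0 τ1 : V ≃ₗ[F] V) (x : V) : miyOrbit F τ0 τ1 x = miyOrbit F τ1 τ0 x := by
  rw [miyOrbit, miyOrbit, Set.pair_comm]

theorem ctx_of (h2 : (2 : F) ≠ 0) (hα0 : α ≠ 0) (hα1 : α ≠ 1) (hβ0 : b ≠ 0) (hβ1 : 2 * b ≠ 1)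
    (hαβ : α ≠ 2 * b) (hα2β : α ≠ 2 * (2 * b))
    (A0 : IsAxis F α (2 * b) a0) (A1 : IsAxis F α (2 * b) a1) (τ0 τ1 : V ≃ₗ[F] V)
    (T0 : IsMiyamoto F α (2 * b) a0 τ0) (T1 : IsMiyamoto F α (2 * b) a1 τ1)
    (hreg : HasRegularAxet F a0 a1 τ0 τ1) (hn : (miyOrbit F τ0 τ1 a0).ncard = 2) :
    ∃ (l l' k k' : F) (a2 a3 s p q : V) (φ φ' : V →ₗ[F] F),
      Ctx α b l l' k k' a0 a1 a2 a3 s p q φ φ' := by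
  have hn1 : (miyOrbit F τ1 τ0 a1).ncard = 2 := by
    obtain ⟨e⟩ := hreg
    rw [← orbit_comm, ← hn, ← Nat.card_coe_set_eq, ← Nat.card_coe_set_eq, Nat.card_congr e]
  obtain ⟨ne, h02⟩ := orbit_facts (T0.self A0) (T0.invol A0) (T1.invol A1) hn
  obtain ⟨ne', h13⟩ := orbit_facts (T1.self A1) (T1.invol A1) (T0.invol A0) hn1
  have x1 : 1 - α ≠ 0 := sub_ne_zero.2 hα1.symm
  have x2 : 1 - 2 * b ≠ 0 := sub_ne_zero.2 hβ1.symm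
  obtain ⟨φ, l, k, H⟩ := side_of h2 x1 x2 A0 A1 T0 T1 ne h02 h13
  obtain ⟨φ', l', k', H'⟩ := side_of h2 x1 x2 A1 A0 T1 T0 ne' h13 h02
  rw [mul_comm a1 a0, add_comm a1 a0] at H'
  refine ⟨l, l', k, k', _, _, _, _, _, φ, φ', ⟨h2, hα0, x1, hβ0, sub_ne_zero.2 hαβ, ?_, H, H'⟩⟩
  intro h
  exact hα2β (by linear_combination h)

theorem ctx_sym {l l' k k' : F} {a0 a1 a2 a3 s p q : V} {φ φ' : V →ₗ[F] F}
    (C : Ctx α b l l' k k' a0 a1 a2 a3 s p q φ φ') :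
    ∃ l k : F, Ctx α b l l k k a0 a1 a2 a3 s p q φ φ' := by
  obtain rfl := C.l_eq
  obtain rfl := C.k_eq
  exact ⟨_, _, C⟩

end tb9

section tb10
variable {F : Type u} [Field F] {V : Type v} [NonUnitalNonAssocCommRing V]
  [Module F V] [SMulCommClass F V V] [IsScalarTower F V V]
variable {α β b : F} {a a0 a1 : V}

theorem mem_E10 {x : V} : x ∈ eigSp F a 1 ⊔ eigSp F a 0 ↔ a * (a * x) = a * x := by
  constructor
  · intro h
    obtain ⟨u, hu, z, hz, rfl⟩ := Submodule.mem_sup.1 h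
    rw [mem_eig, one_smul] at hu
    rw [mem_eig, zero_smul] at hz
    simp only [mul_add, hu, hz, add_zero]
  · intro h
    refine Submodule.mem_sup.2 ⟨a * x, ?_, x - a * x, ?_, by abel⟩
    · rw [mem_eig, one_smul, h]
    · rw [mem_eig, zero_smul, mul_sub, h, sub_self]

theorem mem_E10a (hα0 : α ≠ 0) (hα1 : α ≠ 1) {x : V} :
    x ∈ eigSp F a 1 ⊔ eigSp F a 0 ⊔ eigSp F a α ↔
      a * (a * (a * x)) = (1 + α) • (a * (a * x)) - α • (a * x) := by
  constructor
  · intro h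
    obtain ⟨u', hu', y, hy, rfl⟩ := Submodule.mem_sup.1 h
    obtain ⟨u, hu, z, hz, rfl⟩ := Submodule.mem_sup.1 hu'
    rw [mem_eig, one_smul] at hu
    rw [mem_eig, zero_smul] at hz
    rw [mem_eig] at hy
    simp only [mul_add, hu, hz, hy, add_zero, mul_smul_comm]
    module
  · intro h
    have hα1' : α - 1 ≠ 0 := sub_ne_zero.2 hα1
    set P := a * (a * x) - α • (a * x) with hP
    set Q := a * (a * x) - a * x with hQ
    have aP : a * P = P := by
      rw [hP, mul_sub, h, mul_smul_comm]; module
    have aQ : a * Q = α • Q := by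
      rw [hQ, mul_sub, h]; module
    have e : x = (-(α - 1)⁻¹) • P + (x - (-(α - 1)⁻¹) • P - (α * (α - 1))⁻¹ • Q)
        + (α * (α - 1))⁻¹ • Q := by abel
    rw [e]
    refine Submodule.add_mem_sup (Submodule.add_mem_sup ?_ ?_) ?_
    · apply Submodule.smul_mem
      rw [mem_eig, one_smul, aP]
    · rw [mem_eig, zero_smul, mul_sub, mul_sub, mul_smul_comm, mul_smul_comm, aP, aQ, hP, hQ]
      match_scalars <;> field_simp <;> ring
    · exact Submodule.smul_mem _ _ aQ

theorem mem_E4 (hα0 : α ≠ 0) (hα1 : α ≠ 1) (hβ0 : β ≠ 0) (hβ1 : β ≠ 1) (hαβ : α ≠ β) {x : V} :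
    x ∈ eigSp F a 1 ⊔ eigSp F a 0 ⊔ eigSp F a α ⊔ eigSp F a β ↔
      a * (a * (a * (a * x))) = (1 + α + β) • (a * (a * (a * x)))
        - (α + β + α * β) • (a * (a * x)) + (α * β) • (a * x) := by
  constructor
  · intro h
    obtain ⟨v', hv', w, hw, rfl⟩ := Submodule.mem_sup.1 h
    obtain ⟨u', hu', y, hy, rfl⟩ := Submodule.mem_sup.1 hv'
    obtain ⟨u, hu, z, hz, rfl⟩ := Submodule.mem_sup.1 hu'
    rw [mem_eig, one_smul] at hu
    rw [mem_eig, zero_smul] at hz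
    rw [mem_eig] at hy hw
    simp only [mul_add, hu, hz, hy, hw, add_zero, mul_smul_comm]
    module
  · intro h
    have hα1' : α - 1 ≠ 0 := sub_ne_zero.2 hα1
    have hβ1' : β - 1 ≠ 0 := sub_ne_zero.2 hβ1
    have hαβ' : α - β ≠ 0 := sub_ne_zero.2 hαβ
    set P := a * (a * (a * x)) - (α + β) • (a * (a * x)) + (α * β) • (a * x) with hP
    set Q := a * (a * (a * x)) - (1 + β) • (a * (a * x)) + β • (a * x) with hQ
    set R := a * (a * (a * x)) - (1 + α) • (a * (a * x)) + α • (a * x) with hR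
    have aP : a * P = P := by
      rw [hP, mul_add, mul_sub, h, mul_smul_comm, mul_smul_comm]; module
    have aQ : a * Q = α • Q := by
      rw [hQ, mul_add, mul_sub, h, mul_smul_comm, mul_smul_comm]; module
    have aR : a * R = β • R := by
      rw [hR, mul_add, mul_sub, h, mul_smul_comm, mul_smul_comm]; module
    have e : x = ((α - 1) * (β - 1))⁻¹ • P +
        (x - ((α - 1) * (β - 1))⁻¹ • P - (α * (α - 1) * (α - β))⁻¹ • Q
          - (-(β * (β - 1) * (α - β))⁻¹) • R)
        + (α * (α - 1) * (α - β))⁻¹ • Q + (-(β * (β - 1) * (α - β))⁻¹) • R := by abel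
    rw [e]
    refine Submodule.add_mem_sup (Submodule.add_mem_sup (Submodule.add_mem_sup ?_ ?_) ?_) ?_
    · apply Submodule.smul_mem
      rw [mem_eig, one_smul, aP]
    · rw [mem_eig, zero_smul, mul_sub, mul_sub, mul_sub, mul_smul_comm, mul_smul_comm,
        mul_smul_comm, aP, aQ, aR, hP, hQ, hR]
      match_scalars <;> field_simp <;> ring
    · exact Submodule.smul_mem _ _ aQ
    · exact Submodule.smul_mem _ _ aR

theorem axis_transfer {W : Type*} [NonUnitalNonAssocCommRing W]
    [Module F W] [SMulCommClass F W W] [IsScalarTower F W W]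
    (hα0 : α ≠ 0) (hα1 : α ≠ 1) (hβ0 : β ≠ 0) (hβ1 : β ≠ 1) (hαβ : α ≠ β)
    (f g : W →ₗ[F] V) (fm : ∀ x y, f (x * y) = f x * f y) (gm : ∀ x y, g (x * y) = g x * g y)
    (inj : ∀ x y, f x = f y → g x = g y → x = y) {c : W}
    (A : IsAxis F α β (f c)) (B : IsAxis F α β (g c))
    (prim : ∀ x, c * x = x → ∃ r : F, x = r • c) : IsAxis F α β c := by
  have ef : ∀ {x : W} {μ : F}, x ∈ eigSp F c μ → f x ∈ eigSp F (f c) μ := by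
    intro x μ h
    rw [mem_eig] at h ⊢
    rw [← fm, h, map_smul]
  have eg : ∀ {x : W} {μ : F}, x ∈ eigSp F c μ → g x ∈ eigSp F (g c) μ := by
    intro x μ h
    rw [mem_eig] at h ⊢
    rw [← gm, h, map_smul]
  have ee : ∀ {x : W} {μ : F}, f x ∈ eigSp F (f c) μ → g x ∈ eigSp F (g c) μ →
      x ∈ eigSp F c μ := by
    intro x μ h h'
    rw [mem_eig] at h h' ⊢
    apply inj
    · rw [fm, h, map_smul]
    · rw [gm, h', map_smul]
  have idem : c * c = c := inj _ _ (by rw [fm, A.idem]) (by rw [gm, B.idem])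
  refine ⟨idem, ?_, ?_, ?_, ?_, ?_, ?_, ?_, ?_, ?_, ?_, ?_⟩
  · ext x
    rw [mem_eig, one_smul, Submodule.mem_span_singleton]
    constructor
    · intro h
      obtain ⟨r, hr⟩ := prim x h
      exact ⟨r, hr.symm⟩
    · rintro ⟨r, rfl⟩
      rw [mul_smul_comm, idem]
  · rw [eq_top_iff]
    intro x _
    rw [mem_E4 hα0 hα1 hβ0 hβ1 hαβ]
    have h1 : f x ∈ eigSp F (f c) 1 ⊔ eigSp F (f c) 0 ⊔ eigSp F (f c) α ⊔ eigSp F (f c) β := by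
      rw [A.decomp]; trivial
    have h2 : g x ∈ eigSp F (g c) 1 ⊔ eigSp F (g c) 0 ⊔ eigSp F (g c) α ⊔ eigSp F (g c) β := by
      rw [B.decomp]; trivial
    rw [mem_E4 hα0 hα1 hβ0 hβ1 hαβ] at h1 h2
    apply inj
    · simpa only [fm, map_add, map_sub, map_smul] using h1
    · simpa only [gm, map_add, map_sub, map_smul] using h2
  · intro u hu w hw
    apply inj
    · rw [fm, map_zero, A.fusion_one_zero _ (ef hu) _ (ef hw)]
    · rw [gm, map_zero, B.fusion_one_zero _ (eg hu) _ (eg hw)]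
  · intro u hu w hw
    apply ee
    · rw [fm]; exact A.fusion_one_alpha _ (ef hu) _ (ef hw)
    · rw [gm]; exact B.fusion_one_alpha _ (eg hu) _ (eg hw)
  · intro u hu w hw
    apply ee
    · rw [fm]; exact A.fusion_one_beta _ (ef hu) _ (ef hw)
    · rw [gm]; exact B.fusion_one_beta _ (eg hu) _ (eg hw)
  · intro u hu w hw
    apply ee
    · rw [fm]; exact A.fusion_zero_zero _ (ef hu) _ (ef hw)
    · rw [gm]; exact B.fusion_zero_zero _ (eg hu) _ (eg hw)
  · intro u hu w hw
    apply ee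
    · rw [fm]; exact A.fusion_zero_alpha _ (ef hu) _ (ef hw)
    · rw [gm]; exact B.fusion_zero_alpha _ (eg hu) _ (eg hw)
  · intro u hu w hw
    apply ee
    · rw [fm]; exact A.fusion_zero_beta _ (ef hu) _ (ef hw)
    · rw [gm]; exact B.fusion_zero_beta _ (eg hu) _ (eg hw)
  · intro u hu w hw
    have h1 := mem_E10.1 (A.fusion_alpha_alpha _ (ef hu) _ (ef hw))
    have h2 := mem_E10.1 (B.fusion_alpha_alpha _ (eg hu) _ (eg hw))
    rw [mem_E10]
    apply inj
    · simpa only [fm] using h1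
    · simpa only [gm] using h2
  · intro u hu w hw
    apply ee
    · rw [fm]; exact A.fusion_alpha_beta _ (ef hu) _ (ef hw)
    · rw [gm]; exact B.fusion_alpha_beta _ (eg hu) _ (eg hw)
  · intro u hu w hw
    have h1 := (mem_E10a hα0 hα1).1 (A.fusion_beta_beta _ (ef hu) _ (ef hw))
    have h2 := (mem_E10a hα0 hα1).1 (B.fusion_beta_beta _ (eg hu) _ (eg hw))
    rw [mem_E10a hα0 hα1]
    apply inj
    · simpa only [fm, map_add, map_sub, map_smul] using h1
    · simpa only [gm, map_add, map_sub, map_smul] using h2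

/-- the pair `(x, y)` as a function on a two element index type -/
def pr (x y : V) : ULift.{u} Bool → V := fun i => cond i.down x y

variable (F) in
/-- the symmetric cover -/
def Wal (a0 a1 : V) : NonUnitalSubalgebra F (ULift.{u} Bool → V) :=
  NonUnitalAlgebra.adjoin F {pr a0 a1, pr a1 a0}

instance Wal.inst (a0 a1 : V) : NonUnitalNonAssocCommRing (Wal F a0 a1) :=
  { (inferInstance : NonUnitalNonAssocRing (Wal F a0 a1)) with
    mul_comm := fun x y => Subtype.ext (mul_comm x.1 y.1) }

theorem Wal_ind {a0 a1 : V} {P : (ULift.{u} Bool → V) → Prop}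
    (h0 : P (pr a0 a1)) (h1 : P (pr a1 a0)) (hadd : ∀ x y, P x → P y → P (x + y))
    (hz : P 0) (hmul : ∀ x y, P x → P y → P (x * y)) (hs : ∀ (c : F) x, P x → P (c • x))
    {x : ULift.{u} Bool → V} (hx : x ∈ Wal F a0 a1) : P x := by
  induction hx using NonUnitalAlgebra.adjoin_induction with
  | mem x hx =>
    rcases hx with rfl | rfl
    · exact h0
    · exact h1
  | add x y _ _ hx hy => exact hadd _ _ hx hy
  | zero => exact hz
  | mul x y _ _ hx hy => exact hmul _ _ hx hy
  | smul c x _ hx => exact hs _ _ hx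

/-- exchange of the two coordinates -/
def flp (x : ULift.{u} Bool → V) : ULift.{u} Bool → V := fun i => x ⟨!i.down⟩

theorem flp_pr (x y : V) : flp (pr x y : ULift.{u} Bool → V) = pr y x := by
  funext ⟨i⟩; cases i <;> rfl

theorem flp_flp (x : ULift.{u} Bool → V) : flp (flp x) = x := by
  funext ⟨i⟩; cases i <;> rfl

theorem flp_mem {a0 a1 : V} {x : ULift.{u} Bool → V} (hx : x ∈ Wal F a0 a1) :
    flp x ∈ Wal F a0 a1 := by
  refine Wal_ind (F := F) (P := fun x => flp x ∈ Wal F a0 a1) ?_ ?_ ?_ ?_ ?_ ?_ hx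
  · rw [flp_pr]; exact NonUnitalAlgebra.subset_adjoin F (by simp)
  · rw [flp_pr]; exact NonUnitalAlgebra.subset_adjoin F (by simp)
  · intro x y hx hy
    exact add_mem hx hy
  · exact zero_mem _
  · intro x y hx hy
    exact mul_mem hx hy
  · intro c x hx
    exact SMulMemClass.smul_mem c hx

theorem quot_sym {l k : F} {a2 a3 s p q : V} {φ φ' : V →ₗ[F] F}
    (hα0 : α ≠ 0) (hα1 : α ≠ 1) (hβ0 : β ≠ 0) (hβ1 : β ≠ 1) (hαβ : α ≠ β)
    (C : Ctx α b l l k k a0 a1 a2 a3 s p q φ φ') (hV : IsTwoGenerated F α β a0 a1) :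
    IsQuotientOfSymmetric F α β a0 a1 := by
  have m0 : (pr a0 a1 : ULift.{u} Bool → V) ∈ Wal F a0 a1 :=
    NonUnitalAlgebra.subset_adjoin F (by simp)
  have m1 : (pr a1 a0 : ULift.{u} Bool → V) ∈ Wal F a0 a1 :=
    NonUnitalAlgebra.subset_adjoin F (by simp)
  let W := Wal F a0 a1
  let b0 : W := ⟨_, m0⟩
  let b1 : W := ⟨_, m1⟩
  let f : W →ₗ[F] V :=
    { toFun := fun x => x.1 ⟨true⟩
      map_add' := fun x y => rfl
      map_smul' := fun c x => rfl }
  let g : W →ₗ[F] V :=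
    { toFun := fun x => x.1 ⟨false⟩
      map_add' := fun x y => rfl
      map_smul' := fun c x => rfl }
  let t : W →ₗ[F] W :=
    { toFun := fun x => ⟨flp x.1, flp_mem x.2⟩
      map_add' := fun x y => rfl
      map_smul' := fun c x => rfl }
  have fm : ∀ x y, f (x * y) = f x * f y := fun x y => rfl
  have gm : ∀ x y, g (x * y) = g x * g y := fun x y => rfl
  have tm : ∀ x y, t (x * y) = t x * t y := fun x y => rfl
  have tt : Function.Involutive t := fun x => Subtype.ext (flp_flp x.1)
  have t0 : t b0 = b1 := Subtype.ext (flp_pr _ _)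
  have t1 : t b1 = b0 := Subtype.ext (flp_pr _ _)
  have f0 : f b0 = a0 := rfl
  have f1 : f b1 = a1 := rfl
  have g0 : g b0 = a1 := rfl
  have inj : ∀ x y, f x = f y → g x = g y → x = y := by
    intro x y h h'
    apply Subtype.ext
    funext ⟨i⟩
    cases i
    · exact h'
    · exact h
  have hY : ∀ x : W, (f x, g x) ∈ Ysub F a0 a1 a2 a3 s p q := by
    rintro ⟨x, hx⟩
    change (x ⟨true⟩, x ⟨false⟩) ∈ _
    refine Wal_ind (F := F) (P := fun x => (x ⟨true⟩, x ⟨false⟩) ∈ Ysub F a0 a1 a2 a3 s p q) ?_ ?_ ?_ ?_ ?_ ?_ hx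
    · exact Submodule.subset_span (by simp [pr])
    · exact Submodule.subset_span (by simp [pr])
    · intro x y hx hy
      exact add_mem hx hy
    · exact zero_mem _
    · intro x y hx hy
      exact C.Y_mul hx hy
    · intro c x hx
      exact Submodule.smul_mem _ c hx
  have prim0 : ∀ x, b0 * x = x → ∃ r : F, x = r • b0 := by
    intro x hx
    have h1 : f x ∈ eigSp F a0 1 := by
      rw [mem_eig, one_smul, ← f0, ← fm, hx]
    have h2 : g x ∈ eigSp F a1 1 := by
      rw [mem_eig, one_smul, ← g0, ← gm, hx]
    rw [hV.axis₀.primitive, Submodule.mem_span_singleton] at h1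
    rw [hV.axis₁.primitive, Submodule.mem_span_singleton] at h2
    obtain ⟨c, hc⟩ := h1
    obtain ⟨d, hd⟩ := h2
    have h := C.Y_phi (hY x)
    simp only [← hc, ← hd, map_smul, C.H.φ0, C.H'.φ0, smul_eq_mul, mul_one] at h
    subst h
    refine ⟨c, inj _ _ ?_ ?_⟩
    · rw [map_smul, f0, hc]
    · rw [map_smul, g0, hd]
  have ax0 : IsAxis F α β b0 :=
    axis_transfer hα0 hα1 hβ0 hβ1 hαβ f g fm gm inj hV.axis₀ hV.axis₁ prim0
  have ax1 : IsAxis F α β b1 := by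
    refine axis_transfer hα0 hα1 hβ0 hβ1 hαβ t t tm tm (fun x y h _ => tt.injective h)
      (by rw [t1]; exact ax0) (by rw [t1]; exact ax0) ?_
    intro x hx
    obtain ⟨r, hr⟩ := prim0 (t x) (by rw [← t1, ← tm, hx])
    refine ⟨r, tt.injective ?_⟩
    rw [hr, map_smul, t1]
  have gen : NonUnitalAlgebra.adjoin F {b0, b1} = ⊤ := by
    rw [eq_top_iff]
    rintro ⟨x, hx⟩ -
    have key : ∃ h : x ∈ W, (⟨x, h⟩ : W) ∈ NonUnitalAlgebra.adjoin F {b0, b1} := by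
      refine Wal_ind (F := F) (P := fun x => ∃ h : x ∈ W, (⟨x, h⟩ : W) ∈ NonUnitalAlgebra.adjoin F {b0, b1}) ?_ ?_ ?_ ?_ ?_ ?_ hx
      · exact ⟨m0, NonUnitalAlgebra.subset_adjoin F (Or.inl rfl)⟩
      · exact ⟨m1, NonUnitalAlgebra.subset_adjoin F (Or.inr rfl)⟩
      · intro x y hx hy
        obtain ⟨h, h'⟩ := hx
        obtain ⟨j, j'⟩ := hy
        exact ⟨add_mem h j, add_mem h' j'⟩
      · exact ⟨zero_mem _, zero_mem _⟩
      · intro x y hx hy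
        obtain ⟨h, h'⟩ := hx
        obtain ⟨j, j'⟩ := hy
        exact ⟨mul_mem h j, mul_mem h' j'⟩
      · intro c x hx
        obtain ⟨h, h'⟩ := hx
        exact ⟨SMulMemClass.smul_mem c h, SMulMemClass.smul_mem c h'⟩
    exact key.2
  refine ⟨⟨W⟩, b0, b1, ⟨ax0, ax1, gen⟩, ⟨LinearEquiv.ofInvolutive t tt, tm, t0, t1⟩, f, ?_, fm, ?_⟩
  · intro v
    have hv : v ∈ NonUnitalAlgebra.adjoin F {a0, a1} := by rw [hV.generates]; trivial
    induction hv using NonUnitalAlgebra.adjoin_induction with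
    | mem x hx =>
      rcases hx with rfl | rfl
      · exact ⟨b0, rfl⟩
      · exact ⟨b1, rfl⟩
    | add x y _ _ hx hy =>
      obtain ⟨x, rfl⟩ := hx
      obtain ⟨y, rfl⟩ := hy
      exact ⟨x + y, map_add f x y⟩
    | zero => exact ⟨0, map_zero f⟩
    | mul x y _ _ hx hy =>
      obtain ⟨x, rfl⟩ := hx
      obtain ⟨y, rfl⟩ := hy
      exact ⟨x * y, fm x y⟩
    | smul c x _ hx =>
      obtain ⟨x, rfl⟩ := hx
      exact ⟨c • x, map_smul f c x⟩
  · rw [f0, f1]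

end tb10

/-- If `α ≠ 2β` and the axet is regular with `|a₀^Miy| = 2`, then `(V,{a₀,a₁})` is a
quotient of a symmetric algebra, or `V = V_e`, or `V = V_o`. -/
theorem teo2 {α β : F}
    (hchar : (2 : F) ≠ 0)
    (hα0 : α ≠ 0) (hα1 : α ≠ 1) (hβ0 : β ≠ 0) (hβ1 : β ≠ 1) (hαβ : α ≠ β)
    (hα2β : α ≠ 2 * β)
    {a₀ a₁ : V} (hV : IsTwoGenerated F α β a₀ a₁)
    (τ₀ τ₁ : V ≃ₗ[F] V) (hτ₀ : IsMiyamoto F α β a₀ τ₀) (hτ₁ : IsMiyamoto F α β a₁ τ₁)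
    (a : ℤ → V) (ha : a = axSeq F a₀ a₁ τ₀ τ₁)
    (hreg : HasRegularAxet F a₀ a₁ τ₀ τ₁)
    (hn : (miyOrbit F τ₀ τ₁ a₀).ncard = 2) :
    IsQuotientOfSymmetric F α β a₀ a₁ ∨
    NonUnitalAlgebra.adjoin F ({a 0, a 2} : Set V) = ⊤ ∨
    NonUnitalAlgebra.adjoin F ({a (-1), a 1} : Set V) = ⊤ := by
  left
  have hb : 2 * (β / 2) = β := by field_simp
  obtain ⟨h0, h1, hg⟩ := id hV
  obtain ⟨l, l', k, k', a2, a3, s, p, q, φ, φ', C⟩ :=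
    ctx_of (b := β / 2) hchar hα0 hα1 (div_ne_zero hβ0 hchar) (by rwa [hb]) (by rwa [hb])
      (by rwa [hb]) (by rwa [hb]) (by rwa [hb]) τ₀ τ₁ (by rwa [hb]) (by rwa [hb]) hreg hn
  obtain ⟨l, k, C⟩ := ctx_sym C
  exact quot_sym hα0 hα1 hβ0 hβ1 hαβ C hV

end AxialFormal
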